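/- For every z in the upper half-plane ℍ: Φ12(x1(z),…,x6(z)) · Φ18(x1(z),…,x6(z)) − Φ30(x1(z),…,x6(z)) = 0; equivalently, (Σ_{ν} δ_ν^2 + δ_∞^2)(Σ_{ν} δ_ν^3 + δ_∞^3) = (4056/1315)(Σ_{ν} δ_ν^5 + δ_∞^5) when each δ is evaluated at (x1(z),…,x6(z)). -/

import Mathlib

open Complex Finset

noncomputable section

/-- `ζ = exp(2πi/13)`. -/
def zeta13 : ℂ := Complex.exp (2 * Real.pi * Complex.I / 13)

local notation "ζ" => zeta13

/-- The diagonal matrix `T = diag(ζ^7, ζ^11, ζ^8, ζ^6, ζ^2, ζ^5)`. -/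
def Tmat : Matrix (Fin 6) (Fin 6) ℂ :=
  Matrix.diagonal ![ζ ^ 7, ζ ^ 11, ζ ^ 8, ζ ^ 6, ζ ^ 2, ζ ^ 5]

/-- The matrix `S = -(1/√13)·M`. -/
def Smat : Matrix (Fin 6) (Fin 6) ℂ :=
  (-(1 / (Real.sqrt 13 : ℂ))) • Matrix.of
    ![![ζ^12 - ζ, ζ^10 - ζ^3, ζ^4 - ζ^9, ζ^5 - ζ^8, ζ^2 - ζ^11, ζ^6 - ζ^7],
      ![ζ^10 - ζ^3, ζ^4 - ζ^9, ζ^12 - ζ, ζ^2 - ζ^11, ζ^6 - ζ^7, ζ^5 - ζ^8],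
      ![ζ^4 - ζ^9, ζ^12 - ζ, ζ^10 - ζ^3, ζ^6 - ζ^7, ζ^5 - ζ^8, ζ^2 - ζ^11],
      ![ζ^5 - ζ^8, ζ^2 - ζ^11, ζ^6 - ζ^7, ζ - ζ^12, ζ^3 - ζ^10, ζ^9 - ζ^4],
      ![ζ^2 - ζ^11, ζ^6 - ζ^7, ζ^5 - ζ^8, ζ^3 - ζ^10, ζ^9 - ζ^4, ζ - ζ^12],
      ![ζ^6 - ζ^7, ζ^5 - ζ^8, ζ^2 - ζ^11, ζ^9 - ζ^4, ζ - ζ^12, ζ^3 - ζ^10]]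

/-- The matrix `H`, mapping `(z1,…,z6)` to `(z6, z4, z5, −z3, −z1, −z2)`. -/
def Hmat : Matrix (Fin 6) (Fin 6) ℂ :=
  Matrix.of
    ![![0,0,0,0,0,1], ![0,0,0,1,0,0], ![0,0,0,0,1,0],
      ![0,0,-1,0,0,0], ![-1,0,0,0,0,0], ![0,-1,0,0,0,0]]

/-- The senary quadratic forms `A_0, …, A_6` (here `v 0 = z1, …, v 5 = z6`). -/
def A : ℕ → (Fin 6 → ℂ) → ℂ
  | 0, v => v 0 * v 3 + v 1 * v 4 + v 2 * v 5
  | 1, v => v 0 ^ 2 - 2 * v 2 * v 3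
  | 2, v => -v 4 ^ 2 - 2 * v 1 * v 3
  | 3, v => v 1 ^ 2 - 2 * v 0 * v 4
  | 4, v => v 2 ^ 2 - 2 * v 1 * v 5
  | 5, v => -v 3 ^ 2 - 2 * v 0 * v 5
  | 6, v => -v 5 ^ 2 - 2 * v 2 * v 4
  | _, _ => 0

/-- `w_ν = (A0 + ζ^ν A1 + ζ^{4ν} A2 + ζ^{9ν} A3 + ζ^{3ν} A4 + ζ^{12ν} A5 + ζ^{10ν} A6)^2`. -/
def w (ν : ℕ) (v : Fin 6 → ℂ) : ℂ :=
  (A 0 v + ζ ^ ν * A 1 v + ζ ^ (4 * ν) * A 2 v + ζ ^ (9 * ν) * A 3 v +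
    ζ ^ (3 * ν) * A 4 v + ζ ^ (12 * ν) * A 5 v + ζ ^ (10 * ν) * A 6 v) ^ 2

/-- `w_∞ = 13·A0^2`. -/
def winf (v : Fin 6 → ℂ) : ℂ := 13 * A 0 v ^ 2

/-- The senary cubic forms `D_0, …, D_12` (here `v 0 = z1, …, v 5 = z6`). -/
def D : ℕ → (Fin 6 → ℂ) → ℂ
  | 0, v => v 0 * v 1 * v 2
  | 1, v => 2 * v 1 * v 2 ^ 2 + v 1 ^ 2 * v 5 - v 3 ^ 2 * v 4 + v 0 * v 4 * v 5
  | 2, v => -v 5 ^ 3 + v 1 ^ 2 * v 3 - 2 * v 1 * v 4 ^ 2 + v 0 * v 3 * v 4 + 3 * v 2 * v 4 * v 5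
  | 3, v => 2 * v 0 * v 1 ^ 2 + v 0 ^ 2 * v 4 - v 3 * v 5 ^ 2 + v 2 * v 3 * v 4
  | 4, v => -v 1 ^ 2 * v 2 + v 0 * v 5 ^ 2 - 2 * v 3 ^ 2 * v 5 - v 0 * v 2 * v 4
  | 5, v => -v 3 ^ 3 + v 2 ^ 2 * v 4 - 2 * v 2 * v 5 ^ 2 + v 1 * v 4 * v 5 + 3 * v 0 * v 3 * v 5
  | 6, v => -v 4 ^ 3 + v 0 ^ 2 * v 5 - 2 * v 0 * v 3 ^ 2 + v 2 * v 3 * v 5 + 3 * v 1 * v 3 * v 4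
  | 7, v => -v 1 ^ 3 + v 2 * v 3 ^ 2 - v 0 * v 2 * v 5 - 3 * v 0 * v 1 * v 4 + 2 * v 0 ^ 2 * v 3
  | 8, v => -v 0 ^ 3 + v 1 * v 5 ^ 2 - v 1 * v 2 * v 4 - 3 * v 0 * v 2 * v 3 + 2 * v 2 ^ 2 * v 5
  | 9, v => 2 * v 0 ^ 2 * v 2 + v 2 ^ 2 * v 3 - v 4 ^ 2 * v 5 + v 1 * v 3 * v 5
  | 10, v => -v 0 * v 2 ^ 2 + v 1 * v 3 ^ 2 - 2 * v 3 * v 4 ^ 2 - v 0 * v 1 * v 5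
  | 11, v => -v 2 ^ 3 + v 0 * v 4 ^ 2 - v 0 * v 1 * v 3 - 3 * v 1 * v 2 * v 5 + 2 * v 1 ^ 2 * v 4
  | 12, v => -v 0 ^ 2 * v 1 + v 2 * v 4 ^ 2 - 2 * v 4 * v 5 ^ 2 - v 1 * v 2 * v 3
  | _, _ => 0

/-- The senary cubic form `D_∞ = z4 z5 z6`. -/
def Dinf (v : Fin 6 → ℂ) : ℂ := v 3 * v 4 * v 5

/-- The senary sextic forms `G_0, …, G_12`. -/
def Gs : ℕ → (Fin 6 → ℂ) → ℂ
  | 0, v => D 0 v ^ 2 + Dinf v ^ 2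
  | 1, v => -D 7 v ^ 2 + 2 * D 0 v * D 1 v + 10 * Dinf v * D 1 v + 2 * D 2 v * D 12 v
      - 2 * D 3 v * D 11 v - 4 * D 4 v * D 10 v - 2 * D 9 v * D 5 v
  | 2, v => -2 * D 1 v ^ 2 - 4 * D 0 v * D 2 v + 6 * Dinf v * D 2 v - 2 * D 4 v * D 11 v
      + 2 * D 5 v * D 10 v - 2 * D 6 v * D 9 v - 2 * D 7 v * D 8 v
  | 3, v => -D 8 v ^ 2 + 2 * D 0 v * D 3 v + 10 * Dinf v * D 3 v + 2 * D 6 v * D 10 v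
      - 2 * D 9 v * D 7 v - 4 * D 12 v * D 4 v - 2 * D 1 v * D 2 v
  | 4, v => -D 2 v ^ 2 + 10 * D 0 v * D 4 v - 2 * Dinf v * D 4 v + 2 * D 5 v * D 12 v
      - 2 * D 9 v * D 8 v - 4 * D 1 v * D 3 v - 2 * D 10 v * D 7 v
  | 5, v => -2 * D 9 v ^ 2 - 4 * D 0 v * D 5 v + 6 * Dinf v * D 5 v - 2 * D 10 v * D 8 v
      + 2 * D 6 v * D 12 v - 2 * D 2 v * D 3 v - 2 * D 11 v * D 7 v
  | 6, v => -2 * D 3 v ^ 2 - 4 * D 0 v * D 6 v + 6 * Dinf v * D 6 v - 2 * D 12 v * D 7 v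
      + 2 * D 2 v * D 4 v - 2 * D 5 v * D 1 v - 2 * D 8 v * D 11 v
  | 7, v => -2 * D 10 v ^ 2 + 6 * D 0 v * D 7 v + 4 * Dinf v * D 7 v - 2 * D 1 v * D 6 v
      - 2 * D 2 v * D 5 v - 2 * D 8 v * D 12 v - 2 * D 9 v * D 11 v
  | 8, v => -2 * D 4 v ^ 2 + 6 * D 0 v * D 8 v + 4 * Dinf v * D 8 v - 2 * D 3 v * D 5 v
      - 2 * D 6 v * D 2 v - 2 * D 11 v * D 10 v - 2 * D 1 v * D 7 v
  | 9, v => -D 11 v ^ 2 + 2 * D 0 v * D 9 v + 10 * Dinf v * D 9 v + 2 * D 5 v * D 4 v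
      - 2 * D 1 v * D 8 v - 4 * D 10 v * D 12 v - 2 * D 3 v * D 6 v
  | 10, v => -D 5 v ^ 2 + 10 * D 0 v * D 10 v - 2 * Dinf v * D 10 v + 2 * D 6 v * D 4 v
      - 2 * D 3 v * D 7 v - 4 * D 9 v * D 1 v - 2 * D 12 v * D 11 v
  | 11, v => -2 * D 12 v ^ 2 + 6 * D 0 v * D 11 v + 4 * Dinf v * D 11 v - 2 * D 9 v * D 2 v
      - 2 * D 5 v * D 6 v - 2 * D 7 v * D 4 v - 2 * D 3 v * D 8 v
  | 12, v => -D 6 v ^ 2 + 10 * D 0 v * D 12 v - 2 * Dinf v * D 12 v + 2 * D 2 v * D 10 v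
      - 2 * D 1 v * D 11 v - 4 * D 3 v * D 9 v - 2 * D 4 v * D 8 v
  | _, _ => 0

/-- `δ_ν = −13·G0 + Σ_{j=1}^{12} ζ^{jν} G_j`. -/
def deltaF (ν : ℕ) (v : Fin 6 → ℂ) : ℂ :=
  -13 * Gs 0 v + ∑ j ∈ Finset.Icc 1 12, ζ ^ (j * ν) * Gs j v

/-- `δ_∞ = 13^2·G0`. -/
def deltaInf (v : Fin 6 → ℂ) : ℂ := 13 ^ 2 * Gs 0 v

/-- `Φ4 = Σ_ν w_ν + w_∞`. -/
def Phi4 (v : Fin 6 → ℂ) : ℂ := (∑ ν ∈ Finset.range 13, w ν v) + winf v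

/-- `Φ8 = Σ_ν w_ν^2 + w_∞^2`. -/
def Phi8 (v : Fin 6 → ℂ) : ℂ := (∑ ν ∈ Finset.range 13, w ν v ^ 2) + winf v ^ 2

/-- `Φ12′ = −(1/(13·30))(Σ_ν w_ν^3 + w_∞^3)`. -/
def Phi12' (v : Fin 6 → ℂ) : ℂ :=
  -(1 / (13 * 30)) * ((∑ ν ∈ Finset.range 13, w ν v ^ 3) + winf v ^ 3)

/-- `Φ16 = Σ_ν w_ν^4 + w_∞^4`. -/
def Phi16 (v : Fin 6 → ℂ) : ℂ := (∑ ν ∈ Finset.range 13, w ν v ^ 4) + winf v ^ 4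

/-- `Φ20 = (1/(13·25))(Σ_ν w_ν^5 + w_∞^5)`. -/
def Phi20 (v : Fin 6 → ℂ) : ℂ :=
  (1 / (13 * 25)) * ((∑ ν ∈ Finset.range 13, w ν v ^ 5) + winf v ^ 5)

/-- `Φ12 = −(1/(13·52))(Σ_ν δ_ν^2 + δ_∞^2)`. -/
def Phi12 (v : Fin 6 → ℂ) : ℂ :=
  -(1 / (13 * 52)) * ((∑ ν ∈ Finset.range 13, deltaF ν v ^ 2) + deltaInf v ^ 2)

/-- `Φ18 = (1/(13·6))(Σ_ν δ_ν^3 + δ_∞^3)`. -/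
def Phi18 (v : Fin 6 → ℂ) : ℂ :=
  (1 / (13 * 6)) * ((∑ ν ∈ Finset.range 13, deltaF ν v ^ 3) + deltaInf v ^ 3)

/-- `Φ30 = −(1/(13·1315))(Σ_ν δ_ν^5 + δ_∞^5)`. -/
def Phi30 (v : Fin 6 → ℂ) : ℂ :=
  -(1 / (13 * 1315)) * ((∑ ν ∈ Finset.range 13, deltaF ν v ^ 5) + deltaInf v ^ 5)

/-- `q^α = exp(2πiαz)`. -/
def qp (α : ℚ) (z : ℂ) : ℂ := Complex.exp (2 * Real.pi * Complex.I * (α : ℂ) * z)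

/-- `Σ_{n∈ℤ} (−1)^n q^{(13n^2+cn)/2}`. -/
def thetaSum (c : ℤ) (z : ℂ) : ℂ :=
  ∑' n : ℤ, (-1 : ℂ) ^ n * qp ((13 * (n : ℚ) ^ 2 + (c : ℚ) * (n : ℚ)) / 2) z

/-- The theta constants of order 13: `a_1, …, a_6`. -/
def thc : ℕ → ℂ → ℂ
  | 1, z => qp (121 / 104) z * thetaSum 11 z
  | 2, z => qp (49 / 104) z * thetaSum 7 z
  | 3, z => qp (25 / 104) z * thetaSum 5 z
  | 4, z => -(qp (9 / 104) z * thetaSum 3 z)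
  | 5, z => qp (81 / 104) z * thetaSum 9 z
  | 6, z => qp (1 / 104) z * thetaSum 1 z
  | _, _ => 0

/-- The vector `A(z) = (a1(z), …, a6(z))`. -/
def Avec (z : ℂ) : Fin 6 → ℂ := fun i => thc (i.val + 1) z

/-- The Dedekind eta function `η(z) = q^{1/24} Π_{n=1}^∞ (1−q^n)`. -/
def etaF (z : ℂ) : ℂ :=
  qp (1 / 24) z * ∏' n : ℕ, (1 - Complex.exp (2 * Real.pi * Complex.I * z) ^ (n + 1))

/-- The vector `(x1(z), …, x6(z))` with `x_i(z) = η(z)·a_i(z)`. -/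
def X (z : ℂ) : Fin 6 → ℂ := fun i => etaF z * thc (i.val + 1) z

/-- The discriminant `Δ(z) = η(z)^24`. -/
def Delta (z : ℂ) : ℂ := etaF z ^ 24

/-- The Eisenstein series `E4(z) = (1/2) Σ_{gcd(m,n)=1} (mz+n)^{−4}`. -/
def E4 (z : ℂ) : ℂ :=
  (1 / 2) * ∑' p : {p : ℤ × ℤ // Int.gcd p.1 p.2 = 1},
    ((p.1.1 : ℂ) * z + (p.1.2 : ℂ)) ^ (-4 : ℤ)

/-- The Eisenstein series `E6(z) = (1/2) Σ_{gcd(m,n)=1} (mz+n)^{−6}`. -/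
def E6 (z : ℂ) : ℂ :=
  (1 / 2) * ∑' p : {p : ℤ × ℤ // Int.gcd p.1 p.2 = 1},
    ((p.1.1 : ℂ) * z + (p.1.2 : ℂ)) ^ (-6 : ℤ)

lemma zeta13_pow : zeta13 ^ 13 = 1 := by
  rw [zeta13, ← Complex.exp_nat_mul]
  convert Complex.exp_two_pi_mul_I using 2
  push_cast
  ring

lemma isPrimitiveRoot_zeta13 : IsPrimitiveRoot zeta13 13 := by
  simpa [zeta13] using Complex.isPrimitiveRoot_exp 13 (by norm_num)

lemma sum_zeta13_pow : ∑ k ∈ range 13, zeta13 ^ k = 0 :=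
  isPrimitiveRoot_zeta13.geom_sum_eq_zero (by norm_num)

lemma stdAddChar_natCast (k : ℕ) : ZMod.stdAddChar (k : ZMod 13) = zeta13 ^ k := by
  have := ZMod.stdAddChar_coe (N := 13) (k : ℤ)
  rw [zeta13, ← Complex.exp_nat_mul]
  push_cast at this
  rw [this]
  ring_nf

/-- The odd function on `ZMod 13` with values `v` at `1, 3, 9, 8, 11, 7`. -/
def oddExt (v : Fin 6 → ℂ) : ZMod 13 → ℂ :=
  ![0, v 0, -v 4, v 1, -v 2, -v 3, -v 5, v 5, v 3, v 2, -v 1, v 4, -v 0]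

lemma oddExt_neg (v : Fin 6 → ℂ) (k : ZMod 13) : oddExt v (-k) = -oddExt v k := by
  fin_cases k
  · exact (neg_zero (G := ℂ)).symm
  all_goals simp [oddExt]

/-- The sextic form `D_0 ^ 2 + D_∞ ^ 2` in terms of odd functions on `ZMod 13`. -/
def sextic (φ : ZMod 13 → ℂ) : ℂ := (φ 1 * φ 3 * φ 9) ^ 2 + (φ 8 * φ 11 * φ 7) ^ 2

/-- The unnormalised Fourier transform on `ZMod 13`. -/
def fourierSum (φ : ZMod 13 → ℂ) (k : ZMod 13) : ℂ := ∑ l, ZMod.stdAddChar (k * l) * φ l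

/-- Multiplication by the quadratic character `k ↦ e(ν k ^ 2 / 26)`; here `7 = 1 / 2` mod `13`. -/
def twist (ν : ZMod 13) (φ : ZMod 13 → ℂ) (k : ZMod 13) : ℂ :=
  ZMod.stdAddChar (7 * ν * k ^ 2) * φ k

lemma zeta13_pow_mod (n : ℕ) : ζ ^ (n % 13) = ζ ^ n :=
  (pow_eq_pow_mod n zeta13_pow).symm

lemma sum_zmod_eq_sum_range (f : ZMod 13 → ℂ) : ∑ l, f l = ∑ l ∈ range 13, f (l : ZMod 13) := by
  rw [Finset.sum_range]
  exact Finset.sum_congr rfl fun l _ => by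
    rw [show ((Fin.val (n := 13) l : ℕ) : ZMod 13) = l from ZMod.natCast_zmod_val (n := 13) l]

lemma fourierSum_oddExt (v : Fin 6 → ℂ) (k : ℕ) : fourierSum (oddExt v) k =
    (ζ ^ (k % 13) - ζ ^ (12 * k % 13)) * v 0 + (ζ ^ (3 * k % 13) - ζ ^ (10 * k % 13)) * v 1
    + (ζ ^ (9 * k % 13) - ζ ^ (4 * k % 13)) * v 2 + (ζ ^ (8 * k % 13) - ζ ^ (5 * k % 13)) * v 3
    + (ζ ^ (11 * k % 13) - ζ ^ (2 * k % 13)) * v 4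
    + (ζ ^ (7 * k % 13) - ζ ^ (6 * k % 13)) * v 5 := by
  have h (l : ℕ) : ZMod.stdAddChar ((k : ZMod 13) * (l : ZMod 13)) = ζ ^ (l * k) := by
    rw [← Nat.cast_mul, stdAddChar_natCast, mul_comm]
  simp only [zeta13_pow_mod]
  rw [fourierSum, sum_zmod_eq_sum_range]
  simp only [h, Finset.sum_range_succ, Finset.sum_range_zero]
  simp only [show oddExt v (0 : ℕ) = 0 from rfl, show oddExt v (1 : ℕ) = v 0 from rfl,
    show oddExt v (2 : ℕ) = -v 4 from rfl, show oddExt v (3 : ℕ) = v 1 from rfl,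
    show oddExt v (4 : ℕ) = -v 2 from rfl, show oddExt v (5 : ℕ) = -v 3 from rfl,
    show oddExt v (6 : ℕ) = -v 5 from rfl, show oddExt v (7 : ℕ) = v 5 from rfl,
    show oddExt v (8 : ℕ) = v 3 from rfl, show oddExt v (9 : ℕ) = v 2 from rfl,
    show oddExt v (10 : ℕ) = -v 1 from rfl, show oddExt v (11 : ℕ) = v 4 from rfl,
    show oddExt v (12 : ℕ) = -v 0 from rfl]
  ring

set_option maxRecDepth 10000 in
lemma fourierSum_oddExt_prod (v : Fin 6 → ℂ) (A B : ℂ)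
    (hA : A = ζ + ζ ^ 3 + ζ ^ 9 - ζ ^ 12 - ζ ^ 10 - ζ ^ 4)
    (hB : B = ζ ^ 2 + ζ ^ 5 + ζ ^ 6 - ζ ^ 11 - ζ ^ 8 - ζ ^ 7) :
    fourierSum (oddExt v) 1 * fourierSum (oddExt v) 3 * fourierSum (oddExt v) 9 =
    (-2 * A + 3 * B) * D 0 v + (3 * A + 2 * B) * Dinf v - (A + B) * (D 1 v + D 3 v + D 9 v)
    - A * (D 2 v + D 5 v + D 6 v) + (A - B) * (D 4 v + D 10 v + D 12 v)
    - B * (D 7 v + D 8 v + D 11 v) := by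
  have h1 := fourierSum_oddExt v 1
  have h3 := fourierSum_oddExt v 3
  have h9 := fourierSum_oddExt v 9
  norm_num at h1 h3 h9
  rw [h1, h3, h9]
  clear h1 h3 h9
  simp only [D, Dinf]
  subst hA hB
  have h13 := zeta13_pow
  generalize zeta13 = x at *
  have hp (n : ℕ) : x ^ (n + 13) = x ^ n := by rw [pow_add, h13, mul_one]
  ring_nf
  simp only [h13, show x ^ 14 = x ^ 1 from hp 1, show x ^ 15 = x ^ 2 from hp 2, show x ^ 16 = x
    ^ 3 from hp 3, show x ^ 17 = x ^ 4 from hp 4, show x ^ 18 = x ^ 5 from hp 5, show x ^ 19 = x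
    ^ 6 from hp 6, show x ^ 20 = x ^ 7 from hp 7, show x ^ 21 = x ^ 8 from hp 8, show x ^ 22 = x
    ^ 9 from hp 9, show x ^ 23 = x ^ 10 from hp 10, show x ^ 24 = x ^ 11 from hp 11, show x ^ 25
    = x ^ 12 from hp 12, show x ^ 26 = x ^ 13 from hp 13, show x ^ 27 = x ^ 14 from hp 14, show
    x ^ 28 = x ^ 15 from hp 15, show x ^ 29 = x ^ 16 from hp 16, show x ^ 30 = x ^ 17 from hp
    17, show x ^ 31 = x ^ 18 from hp 18, show x ^ 32 = x ^ 19 from hp 19, show x ^ 33 = x ^ 20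
    from hp 20, show x ^ 34 = x ^ 21 from hp 21, show x ^ 35 = x ^ 22 from hp 22, show x ^ 36 =
    x ^ 23 from hp 23]
  ring

lemma fourierSum_oddExt_prod' (v : Fin 6 → ℂ) (A B : ℂ)
    (hA : A = ζ + ζ ^ 3 + ζ ^ 9 - ζ ^ 12 - ζ ^ 10 - ζ ^ 4)
    (hB : B = ζ ^ 2 + ζ ^ 5 + ζ ^ 6 - ζ ^ 11 - ζ ^ 8 - ζ ^ 7) :
    fourierSum (oddExt v) 8 * fourierSum (oddExt v) 11 * fourierSum (oddExt v) 7 =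
    (3 * A + 2 * B) * D 0 v + (2 * A - 3 * B) * Dinf v + (B - A) * (D 1 v + D 3 v + D 9 v)
    + B * (D 2 v + D 5 v + D 6 v) - (A + B) * (D 4 v + D 10 v + D 12 v)
    - A * (D 7 v + D 8 v + D 11 v) := by
  have h := fourierSum_oddExt_prod ![v 3, v 4, v 5, -v 0, -v 1, -v 2] A B hA hB
  have e1 := fourierSum_oddExt v 8
  have e3 := fourierSum_oddExt v 11
  have e9 := fourierSum_oddExt v 7
  have f1 := fourierSum_oddExt ![v 3, v 4, v 5, -v 0, -v 1, -v 2] 1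
  have f3 := fourierSum_oddExt ![v 3, v 4, v 5, -v 0, -v 1, -v 2] 3
  have f9 := fourierSum_oddExt ![v 3, v 4, v 5, -v 0, -v 1, -v 2] 9
  norm_num at e1 e3 e9 f1 f3 f9
  have g1 : fourierSum (oddExt ![v 3, v 4, v 5, -v 0, -v 1, -v 2]) 1 =
      -fourierSum (oddExt v) 8 := by
    rw [f1, e1]
    simp only [Matrix.cons_val]
    ring
  have g3 : fourierSum (oddExt ![v 3, v 4, v 5, -v 0, -v 1, -v 2]) 3 =
      -fourierSum (oddExt v) 11 := by
    rw [f3, e3]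
    simp only [Matrix.cons_val]
    ring
  have g9 : fourierSum (oddExt ![v 3, v 4, v 5, -v 0, -v 1, -v 2]) 9 =
      -fourierSum (oddExt v) 7 := by
    rw [f9, e9]
    simp only [Matrix.cons_val]
    ring
  rw [g1, g3, g9] at h
  simp only [D, Dinf, Matrix.cons_val] at h ⊢
  linear_combination -h

lemma sextic_fourierSum_oddExt (v : Fin 6 → ℂ) :
    sextic (fourierSum (oddExt v)) = 13 * deltaF 0 v := by
  obtain ⟨A, hA⟩ : ∃ A, A = ζ + ζ ^ 3 + ζ ^ 9 - ζ ^ 12 - ζ ^ 10 - ζ ^ 4 := ⟨_, rfl⟩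
  obtain ⟨B, hB⟩ : ∃ B, B = ζ ^ 2 + ζ ^ 5 + ζ ^ 6 - ζ ^ 11 - ζ ^ 8 - ζ ^ 7 := ⟨_, rfl⟩
  have hAB : A ^ 2 + B ^ 2 = -13 := by
    have h13 := zeta13_pow
    have hs := sum_zeta13_pow
    simp only [Finset.sum_range_succ, Finset.sum_range_zero] at hs
    subst hA hB
    generalize zeta13 = x at *
    grind
  rw [sextic, fourierSum_oddExt_prod v A B hA hB, fourierSum_oddExt_prod' v A B hA hB]
  have hd : deltaF 0 v = -13 * Gs 0 v + (Gs 1 v + Gs 2 v + Gs 3 v + Gs 4 v + Gs 5 v + Gs 6 v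
      + Gs 7 v + Gs 8 v + Gs 9 v + Gs 10 v + Gs 11 v + Gs 12 v) := by
    simp [deltaF, Finset.sum_Icc_succ_top]
  rw [hd]
  simp only [Gs]
  generalize D 0 v = d0, D 1 v = d1, D 2 v = d2, D 3 v = d3, D 4 v = d4, D 5 v = d5, D 6 v = d6,
    D 7 v = d7, D 8 v = d8, D 9 v = d9, D 10 v = d10, D 11 v = d11, D 12 v = d12, Dinf v = di
  linear_combination -(-13 * d0 * d0 - 13 * di * di - 1 * d7 * d7 + 2 * d0 * d1
    + 10 * d1 * di + 2 * d2 * d12 - 2 * d3 * d11 - 4 * d4 * d10 - 2 * d5 * d9 - 2 * d1 * d1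
    - 4 * d0 * d2 + 6 * d2 * di - 2 * d4 * d11 + 2 * d5 * d10 - 2 * d6 * d9 - 2 * d7 * d8
    - 1 * d8 * d8 + 2 * d0 * d3 + 10 * d3 * di + 2 * d6 * d10 - 2 * d7 * d9 - 4 * d4 * d12
    - 2 * d1 * d2 - 1 * d2 * d2 + 10 * d0 * d4 - 2 * d4 * di + 2 * d5 * d12 - 2 * d8 * d9
    - 4 * d1 * d3 - 2 * d7 * d10 - 2 * d9 * d9 - 4 * d0 * d5 + 6 * d5 * di - 2 * d8 * d10
    + 2 * d6 * d12 - 2 * d2 * d3 - 2 * d7 * d11 - 2 * d3 * d3 - 4 * d0 * d6 + 6 * d6 * di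
    - 2 * d7 * d12 + 2 * d2 * d4 - 2 * d1 * d5 - 2 * d8 * d11 - 2 * d10 * d10 + 6 * d0 * d7
    + 4 * d7 * di - 2 * d1 * d6 - 2 * d2 * d5 - 2 * d8 * d12 - 2 * d9 * d11 - 2 * d4 * d4
    + 6 * d0 * d8 + 4 * d8 * di - 2 * d3 * d5 - 2 * d2 * d6 - 2 * d10 * d11 - 2 * d1 * d7
    - 1 * d11 * d11 + 2 * d0 * d9 + 10 * d9 * di + 2 * d4 * d5 - 2 * d1 * d8 - 4 * d10 * d12
    - 2 * d3 * d6 - 1 * d5 * d5 + 10 * d0 * d10 - 2 * d10 * di + 2 * d4 * d6 - 2 * d3 * d7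
    - 4 * d1 * d9 - 2 * d11 * d12 - 2 * d12 * d12 + 6 * d0 * d11 + 4 * d11 * di - 2 * d2 * d9
    - 2 * d5 * d6 - 2 * d4 * d7 - 2 * d3 * d8 - 1 * d6 * d6 + 10 * d0 * d12 - 2 * d12 * di
    + 2 * d2 * d10 - 2 * d1 * d11 - 4 * d3 * d9 - 2 * d4 * d8) * hAB

/-- The diagonal action `v ↦ (ω^7 v1, ω^11 v2, ω^8 v3, ω^6 v4, ω^2 v5, ω^5 v6)`. -/
def diagVec (ω : ℂ) (v : Fin 6 → ℂ) : Fin 6 → ℂ :=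
  ![ω ^ 7 * v 0, ω ^ 11 * v 1, ω ^ 8 * v 2, ω ^ 6 * v 3, ω ^ 2 * v 4, ω ^ 5 * v 5]

lemma D_diagVec {ω : ℂ} (hω : ω ^ 13 = 1) (v : Fin 6 → ℂ) {j : ℕ} (hj : j ≤ 12) :
    D j (diagVec ω v) = ω ^ j * D j v := by
  have hp (n : ℕ) : ω ^ (n + 13) = ω ^ n := by rw [pow_add, hω, mul_one]
  interval_cases j <;> simp only [D, diagVec, Matrix.cons_val] <;> ring_nf <;>
    simp only [hω, show ω ^ 14 = ω ^ 1 from hp 1, show ω ^ 15 = ω ^ 2 from hp 2,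
      show ω ^ 16 = ω ^ 3 from hp 3, show ω ^ 17 = ω ^ 4 from hp 4,
      show ω ^ 18 = ω ^ 5 from hp 5, show ω ^ 19 = ω ^ 6 from hp 6,
      show ω ^ 20 = ω ^ 7 from hp 7, show ω ^ 21 = ω ^ 8 from hp 8,
      show ω ^ 22 = ω ^ 9 from hp 9, show ω ^ 23 = ω ^ 10 from hp 10,
      show ω ^ 24 = ω ^ 11 from hp 11, show ω ^ 25 = ω ^ 12 from hp 12,
      show ω ^ 26 = ω ^ 13 from hp 13, show ω ^ 27 = ω ^ 14 from hp 14,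
      show ω ^ 28 = ω ^ 15 from hp 15, show ω ^ 29 = ω ^ 16 from hp 16,
      show ω ^ 30 = ω ^ 17 from hp 17, show ω ^ 33 = ω ^ 20 from hp 20] <;> ring

lemma Dinf_diagVec {ω : ℂ} (hω : ω ^ 13 = 1) (v : Fin 6 → ℂ) :
    Dinf (diagVec ω v) = Dinf v := by
  simp only [Dinf, diagVec, Matrix.cons_val]
  linear_combination v 3 * v 4 * v 5 * hω

lemma Gs_diagVec {ω : ℂ} (hω : ω ^ 13 = 1) (v : Fin 6 → ℂ) {j : ℕ} (hj : j ≤ 12) :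
    Gs j (diagVec ω v) = ω ^ j * Gs j v := by
  have hp (n : ℕ) : ω ^ (n + 13) = ω ^ n := by rw [pow_add, hω, mul_one]
  have h0 := D_diagVec hω v (j := 0) (by norm_num)
  have h1 := D_diagVec hω v (j := 1) (by norm_num)
  have h2 := D_diagVec hω v (j := 2) (by norm_num)
  have h3 := D_diagVec hω v (j := 3) (by norm_num)
  have h4 := D_diagVec hω v (j := 4) (by norm_num)
  have h5 := D_diagVec hω v (j := 5) (by norm_num)
  have h6 := D_diagVec hω v (j := 6) (by norm_num)
  have h7 := D_diagVec hω v (j := 7) (by norm_num)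
  have h8 := D_diagVec hω v (j := 8) (by norm_num)
  have h9 := D_diagVec hω v (j := 9) (by norm_num)
  have h10 := D_diagVec hω v (j := 10) (by norm_num)
  have h11 := D_diagVec hω v (j := 11) (by norm_num)
  have h12 := D_diagVec hω v (j := 12) (by norm_num)
  interval_cases j <;> simp only [Gs, h0, h1, h2, h3, h4, h5, h6, h7, h8, h9, h10, h11, h12,
      Dinf_diagVec hω] <;> ring_nf <;>
    simp only [show ω ^ 14 = ω ^ 1 from hp 1, show ω ^ 15 = ω ^ 2 from hp 2,
      show ω ^ 16 = ω ^ 3 from hp 3, show ω ^ 17 = ω ^ 4 from hp 4,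
      show ω ^ 18 = ω ^ 5 from hp 5, show ω ^ 19 = ω ^ 6 from hp 6,
      show ω ^ 20 = ω ^ 7 from hp 7, show ω ^ 21 = ω ^ 8 from hp 8,
      show ω ^ 22 = ω ^ 9 from hp 9, show ω ^ 23 = ω ^ 10 from hp 10,
      show ω ^ 24 = ω ^ 11 from hp 11] <;> ring

lemma deltaF_diagVec (ν : ℕ) (v : Fin 6 → ℂ) : deltaF 0 (diagVec (ζ ^ ν) v) = deltaF ν v := by
  have hω : (ζ ^ ν) ^ 13 = 1 := by rw [← pow_mul, mul_comm, pow_mul, zeta13_pow, one_pow]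
  rw [deltaF, deltaF, Gs_diagVec hω v (by norm_num), pow_zero, one_mul]
  congr 1
  refine Finset.sum_congr rfl fun j hj => ?_
  rw [Gs_diagVec hω v (Finset.mem_Icc.1 hj).2, mul_zero, pow_zero, one_mul, ← pow_mul, mul_comm ν]

lemma twist_oddExt (ν : ℕ) (v : Fin 6 → ℂ) :
    twist ν (oddExt v) = oddExt (diagVec (ζ ^ ν) v) := by
  have h (a : ℕ) : ZMod.stdAddChar (7 * (ν : ZMod 13) * (a : ZMod 13) ^ 2) =
      ζ ^ (7 * a ^ 2 % 13 * ν) := by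
    rw [← stdAddChar_natCast]
    congr 1
    push_cast
    rw [ZMod.natCast_mod]
    push_cast
    ring
  have key (k : ℕ) : twist ν (oddExt v) k = ζ ^ (7 * k ^ 2 % 13 * ν) * oddExt v k := by
    rw [twist, h]
  funext k
  rw [← ZMod.natCast_zmod_val k, key]
  generalize hn : k.val = n
  have : n < 13 := hn ▸ ZMod.val_lt k
  interval_cases n <;> simp [oddExt, diagVec, ← pow_mul, mul_comm ν]

lemma deltaF_eq_sextic (ν : ℕ) (v : Fin 6 → ℂ) :
    deltaF ν v = sextic (fourierSum (twist ν (oddExt v))) / 13 := by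
  rw [twist_oddExt, sextic_fourierSum_oddExt, deltaF_diagVec]
  ring

lemma deltaInf_eq_sextic (v : Fin 6 → ℂ) : deltaInf v = 169 * sextic (oddExt v) := by
  have h1 : oddExt v 1 = v 0 := rfl
  have h3 : oddExt v 3 = v 1 := rfl
  have h9 : oddExt v 9 = v 2 := rfl
  have h8 : oddExt v 8 = v 3 := rfl
  have h11 : oddExt v 11 = v 4 := rfl
  have h7 : oddExt v 7 = v 5 := rfl
  rw [deltaInf, Gs, D, Dinf, sextic, h1, h3, h9, h8, h11, h7]
  ring

lemma sextic_smul (c : ℂ) (φ : ZMod 13 → ℂ) : sextic (c • φ) = c ^ 6 * sextic φ := by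
  simp only [sextic, Pi.smul_apply, smul_eq_mul]
  ring

lemma fourierSum_smul (c : ℂ) (φ : ZMod 13 → ℂ) : fourierSum (c • φ) = c • fourierSum φ := by
  funext k
  simp only [fourierSum, Pi.smul_apply, smul_eq_mul, Finset.mul_sum]
  exact Finset.sum_congr rfl fun l _ => by ring

lemma twist_smul (ν : ZMod 13) (c : ℂ) (φ : ZMod 13 → ℂ) : twist ν (c • φ) = c • twist ν φ := by
  funext k
  simp only [twist, Pi.smul_apply, smul_eq_mul]
  ring

lemma twist_twist (μ ν : ZMod 13) (φ : ZMod 13 → ℂ) : twist μ (twist ν φ) = twist (μ + ν) φ := by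
  funext k
  rw [twist, twist, twist, ← mul_assoc, ← AddChar.map_add_eq_mul]
  ring_nf

lemma twist_zero (φ : ZMod 13 → ℂ) : twist 0 φ = φ := by
  funext k
  simp [twist]

lemma twist_neg {φ : ZMod 13 → ℂ} (h : ∀ k, φ (-k) = -φ k) (ν k : ZMod 13) :
    twist ν φ (-k) = -twist ν φ k := by
  rw [twist, twist, h, neg_sq, mul_neg]

lemma fourierSum_neg {φ : ZMod 13 → ℂ} (h : ∀ k, φ (-k) = -φ k) (k : ZMod 13) :
    fourierSum φ (-k) = -fourierSum φ k := by
  rw [fourierSum, fourierSum, ← Finset.sum_neg_distrib, ← Equiv.sum_comp (Equiv.neg (ZMod 13))]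
  exact Finset.sum_congr rfl fun l _ => by simp [h]

lemma sextic_twist (ν : ZMod 13) (φ : ZMod 13 → ℂ) : sextic (twist ν φ) = sextic φ := by
  have h (a b c : ZMod 13) (habc : a ^ 2 + b ^ 2 + c ^ 2 = 0) :
      twist ν φ a * twist ν φ b * twist ν φ c = φ a * φ b * φ c := by
    have : ZMod.stdAddChar (7 * ν * a ^ 2) * ZMod.stdAddChar (7 * ν * b ^ 2) *
        ZMod.stdAddChar (7 * ν * c ^ 2) = 1 := by
      rw [← AddChar.map_add_eq_mul, ← AddChar.map_add_eq_mul, ← mul_add, ← mul_add, habc,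
        mul_zero, AddChar.map_zero_eq_one]
    simp only [twist]
    linear_combination φ a * φ b * φ c * this
  rw [sextic, sextic, h 1 3 9 (by decide), h 8 11 7 (by decide)]

lemma sextic_comp_mul {φ : ZMod 13 → ℂ} (h : ∀ k, φ (-k) = -φ k) {u : ZMod 13} (hu : u ≠ 0) :
    sextic (fun k => φ (u * k)) = sextic φ := by
  have h12 : φ 12 = -φ 1 := h 1
  have h10 : φ 10 = -φ 3 := h 3
  have h4 : φ 4 = -φ 9 := h 9
  have h5 : φ 5 = -φ 8 := h 8
  have h2 : φ 2 = -φ 11 := h 11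
  have h6 : φ 6 = -φ 7 := h 7
  simp only [sextic]
  fin_cases u
  · exact absurd rfl hu
  · change (φ 1 * φ 3 * φ 9) ^ 2 + (φ 8 * φ 11 * φ 7) ^ 2 = _
    ring
  · change (φ 2 * φ 6 * φ 5) ^ 2 + (φ 3 * φ 9 * φ 1) ^ 2 = _
    rw [h2, h6, h5]
    ring
  · change (φ 3 * φ 9 * φ 1) ^ 2 + (φ 11 * φ 7 * φ 8) ^ 2 = _
    ring
  · change (φ 4 * φ 12 * φ 10) ^ 2 + (φ 6 * φ 5 * φ 2) ^ 2 = _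
    rw [h4, h12, h10, h6, h5, h2]
    ring
  · change (φ 5 * φ 2 * φ 6) ^ 2 + (φ 1 * φ 3 * φ 9) ^ 2 = _
    rw [h5, h2, h6]
    ring
  · change (φ 6 * φ 5 * φ 2) ^ 2 + (φ 9 * φ 1 * φ 3) ^ 2 = _
    rw [h5, h2, h6]
    ring
  · change (φ 7 * φ 8 * φ 11) ^ 2 + (φ 4 * φ 12 * φ 10) ^ 2 = _
    rw [h4, h12, h10]
    ring
  · change (φ 8 * φ 11 * φ 7) ^ 2 + (φ 12 * φ 10 * φ 4) ^ 2 = _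
    rw [h4, h12, h10]
    ring
  · change (φ 9 * φ 1 * φ 3) ^ 2 + (φ 7 * φ 8 * φ 11) ^ 2 = _
    ring
  · change (φ 10 * φ 4 * φ 12) ^ 2 + (φ 2 * φ 6 * φ 5) ^ 2 = _
    rw [h4, h12, h10, h6, h5, h2]
    ring
  · change (φ 11 * φ 7 * φ 8) ^ 2 + (φ 10 * φ 4 * φ 12) ^ 2 = _
    rw [h4, h12, h10]
    ring
  · change (φ 12 * φ 10 * φ 4) ^ 2 + (φ 5 * φ 2 * φ 6) ^ 2 = _
    rw [h4, h12, h10, h6, h5, h2]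
    ring

lemma sum_stdAddChar_mul (b : ZMod 13) :
    ∑ x : ZMod 13, ZMod.stdAddChar (x * b) = if b = 0 then (13 : ℂ) else 0 := by
  have := AddChar.sum_mulShift b (ZMod.isPrimitive_stdAddChar 13)
  simpa using this

lemma fourierSum_fourierSum (φ : ZMod 13 → ℂ) (k : ZMod 13) :
    fourierSum (fourierSum φ) k = 13 * φ (-k) := by
  have h (m : ZMod 13) : ∑ l : ZMod 13, ZMod.stdAddChar (k * l) * (ZMod.stdAddChar (l * m) * φ m) =
      if m = -k then 13 * φ m else 0 := by
    have : ∀ l : ZMod 13, ZMod.stdAddChar (k * l) * (ZMod.stdAddChar (l * m) * φ m) =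
        ZMod.stdAddChar (l * (m + k)) * φ m := fun l => by
      rw [← mul_assoc, ← AddChar.map_add_eq_mul]
      ring_nf
    simp only [this]
    rw [← Finset.sum_mul, sum_stdAddChar_mul]
    simp [eq_neg_iff_add_eq_zero]
  simp only [fourierSum, Finset.mul_sum]
  rw [Finset.sum_comm]
  simp [h]

/-- The quadratic Gauss sum `∑ e(ν l ^ 2 / 26)` modulo `13`. -/
def quadGauss (ν : ZMod 13) : ℂ := ∑ l : ZMod 13, ZMod.stdAddChar (7 * ν * l ^ 2)

instance fact_prime_thirteen : Fact (Nat.Prime 13) := ⟨by norm_num⟩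

lemma quadGauss_sq {ν : ZMod 13} (hν : ν ≠ 0) : quadGauss ν ^ 2 = 13 := by
  have h1 : quadGauss ν = ∑ l : ZMod 13, ZMod.stdAddChar (-(7 * ν * l ^ 2)) := by
    rw [quadGauss, ← Equiv.sum_comp (Equiv.mulLeft₀ (5 : ZMod 13) (by decide))]
    refine Finset.sum_congr rfl fun l _ => congrArg _ ?_
    have : (25 : ZMod 13) = -1 := by decide
    simp only [Equiv.mulLeft₀_apply]
    linear_combination 7 * ν * l ^ 2 * this
  have h14 : (14 : ZMod 13) = 1 := by decide
  rw [sq]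
  nth_rewrite 1 [h1]
  rw [quadGauss, Finset.sum_mul]
  have h2 (m : ZMod 13) : ZMod.stdAddChar (-(7 * ν * m ^ 2)) *
      ∑ l : ZMod 13, ZMod.stdAddChar (7 * ν * l ^ 2) =
      ∑ t : ZMod 13, ZMod.stdAddChar (7 * ν * t ^ 2) * ZMod.stdAddChar (m * (ν * t)) := by
    rw [← Equiv.sum_comp (Equiv.addLeft m), Finset.mul_sum]
    refine Finset.sum_congr rfl fun t _ => ?_
    rw [← AddChar.map_add_eq_mul, ← AddChar.map_add_eq_mul]
    congr 1
    simp only [Equiv.coe_addLeft]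
    linear_combination m * t * ν * h14
  simp only [h2]
  rw [Finset.sum_comm]
  simp only [← Finset.mul_sum, sum_stdAddChar_mul]
  simp [hν]

lemma fourierSum_twist_fourierSum {ν : ZMod 13} (hν : ν ≠ 0) (φ : ZMod 13 → ℂ) :
    fourierSum (twist ν (fourierSum φ)) =
      quadGauss ν • twist (-ν⁻¹) (fun k => fourierSum (twist (-ν⁻¹) φ) (-ν⁻¹ * k)) := by
  have h14 : (14 : ZMod 13) = 1 := by decide
  have hνν : ν * ν⁻¹ = 1 := mul_inv_cancel₀ hν
  funext k
  have h (m : ZMod 13) : ∑ l : ZMod 13, ZMod.stdAddChar (k * l) * (ZMod.stdAddChar (7 * ν * l ^ 2) *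
      (ZMod.stdAddChar (l * m) * φ m)) =
      quadGauss ν * (ZMod.stdAddChar (7 * -ν⁻¹ * k ^ 2) * (ZMod.stdAddChar (-ν⁻¹ * k * m) *
        (ZMod.stdAddChar (7 * -ν⁻¹ * m ^ 2) * φ m))) := by
    rw [quadGauss, ← Equiv.sum_comp (Equiv.addRight (-((k + m) * ν⁻¹))), Finset.sum_mul]
    refine Finset.sum_congr rfl fun l _ => ?_
    simp only [← mul_assoc, ← AddChar.map_add_eq_mul, Equiv.coe_addRight]
    congr 2
    linear_combination (-14 * l * (k + m) + 7 * (k + m) ^ 2 * ν⁻¹) * hνν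
      + (-l * (k + m) + ν⁻¹ * (k ^ 2 + m ^ 2 + k * m)) * h14
  simp only [fourierSum, twist, Finset.mul_sum, Pi.smul_apply, smul_eq_mul]
  rw [Finset.sum_comm]
  exact Finset.sum_congr rfl fun m _ => h m

/-- The power sums of the forms `δ_∞, δ_0, …, δ_12`, as functions on `ZMod 13`. -/
def deltaPowerSum (n : ℕ) (φ : ZMod 13 → ℂ) : ℂ :=
  (169 * sextic φ) ^ n + ∑ ν : ZMod 13, (sextic (fourierSum (twist ν φ)) / 13) ^ n

lemma deltaPowerSum_oddExt (n : ℕ) (v : Fin 6 → ℂ) :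
    deltaPowerSum n (oddExt v) = (∑ ν ∈ range 13, deltaF ν v ^ n) + deltaInf v ^ n := by
  rw [deltaPowerSum, sum_zmod_eq_sum_range, ← deltaInf_eq_sextic, add_comm]
  simp only [← deltaF_eq_sextic]

lemma deltaPowerSum_smul (n : ℕ) (c : ℂ) (φ : ZMod 13 → ℂ) :
    deltaPowerSum n (c • φ) = c ^ (6 * n) * deltaPowerSum n φ := by
  simp only [deltaPowerSum, twist_smul, fourierSum_smul, sextic_smul, mul_add, Finset.mul_sum,
    pow_mul, ← mul_pow]
  congr 1
  · ring
  · exact Finset.sum_congr rfl fun ν _ => by ring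

lemma deltaPowerSum_twist (n : ℕ) (μ : ZMod 13) (φ : ZMod 13 → ℂ) :
    deltaPowerSum n (twist μ φ) = deltaPowerSum n φ := by
  simp only [deltaPowerSum, twist_twist, sextic_twist]
  have := Equiv.sum_comp (Equiv.addRight μ) fun ν => (sextic (fourierSum (twist ν φ)) / 13) ^ n
  simp only [Equiv.coe_addRight] at this
  rw [this]

lemma deltaPowerSum_fourierSum (n : ℕ) {φ : ZMod 13 → ℂ} (h : ∀ k, φ (-k) = -φ k) :
    deltaPowerSum n (fourierSum φ) = 13 ^ (3 * n) * deltaPowerSum n φ := by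
  have h0 : sextic (fourierSum (fourierSum φ)) = 13 ^ 6 * sextic φ := by
    have : fourierSum (fourierSum φ) = (-13 : ℂ) • φ := by
      funext k
      simp [fourierSum_fourierSum, h]
    rw [this, sextic_smul]
    norm_num
  have h1 {ν : ZMod 13} (hν : ν ≠ 0) : sextic (fourierSum (twist ν (fourierSum φ))) =
      13 ^ 3 * sextic (fourierSum (twist (-ν⁻¹) φ)) := by
    rw [fourierSum_twist_fourierSum hν, sextic_smul, sextic_twist,
      sextic_comp_mul (fourierSum_neg (twist_neg h _)) (by simpa using hν),
      show quadGauss ν ^ 6 = (quadGauss ν ^ 2) ^ 3 by ring, quadGauss_sq hν]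
  have h2 : ∑ ν ∈ univ.erase (0 : ZMod 13),
      (sextic (fourierSum (twist ν (fourierSum φ))) / 13) ^ n =
      13 ^ (3 * n) * ∑ ν ∈ univ.erase (0 : ZMod 13), (sextic (fourierSum (twist ν φ)) / 13) ^ n := by
    rw [Finset.mul_sum]
    refine Finset.sum_nbij' (fun ν => -ν⁻¹) (fun ν => -ν⁻¹) ?_ ?_ ?_ ?_ ?_
    · simp
    · simp
    · simp [inv_neg]
    · simp [inv_neg]
    · intro ν hν
      rw [h1 (Finset.ne_of_mem_erase hν), pow_mul, ← mul_pow, mul_div_assoc]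
  have hs (f : ZMod 13 → ℂ) : ∑ ν, f ν = f 0 + ∑ ν ∈ univ.erase (0 : ZMod 13), f ν :=
    (Finset.add_sum_erase univ f (Finset.mem_univ 0)).symm
  have e1 : (169 * sextic (fourierSum φ)) ^ n =
      13 ^ (3 * n) * (sextic (fourierSum φ) / 13) ^ n := by
    rw [pow_mul, ← mul_pow]
    congr 1
    ring
  have e2 : (13 ^ 6 * sextic φ / 13) ^ n = 13 ^ (3 * n) * (169 * sextic φ) ^ n := by
    rw [pow_mul, ← mul_pow]
    congr 1
    ring
  rw [deltaPowerSum, deltaPowerSum, hs fun ν => (sextic (fourierSum (twist ν φ)) / 13) ^ n,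
    hs fun ν => (sextic (fourierSum (twist ν (fourierSum φ))) / 13) ^ n, h2, twist_zero,
    twist_zero, h0]
  linear_combination e1 + e2

/-- The form `p_2 p_3 - (4056 / 1315) p_5` in the power sums `p_n` of the `δ`'s. -/
def relationForm (φ : ZMod 13 → ℂ) : ℂ :=
  deltaPowerSum 2 φ * deltaPowerSum 3 φ - 4056 / 1315 * deltaPowerSum 5 φ

lemma relationForm_smul (c : ℂ) (φ : ZMod 13 → ℂ) :
    relationForm (c • φ) = c ^ 30 * relationForm φ := by
  simp only [relationForm, deltaPowerSum_smul]
  ring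

lemma relationForm_twist (μ : ZMod 13) (φ : ZMod 13 → ℂ) :
    relationForm (twist μ φ) = relationForm φ := by
  simp only [relationForm, deltaPowerSum_twist]

lemma relationForm_fourierSum {φ : ZMod 13 → ℂ} (h : ∀ k, φ (-k) = -φ k) :
    relationForm (fourierSum φ) = 13 ^ 15 * relationForm φ := by
  simp only [relationForm, deltaPowerSum_fourierSum _ h]
  ring

/-- The summand `(-1)^N e(z (2N+1)^2 / 104)` of the theta constants of order `13`. -/
def triTerm (N : ℤ) (z : ℂ) : ℂ :=
  (-1) ^ N * cexp (Real.pi * I * z * (2 * N + 1) ^ 2 / 52)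

/-- The theta constant obtained by summing over a residue class modulo `13`. -/
def thetaRes (r : ℤ) (z : ℂ) : ℂ := ∑' n : ℤ, triTerm (13 * n + r) z

lemma cexp_pi_mul_I_mul_int (n : ℤ) : cexp (Real.pi * I * n) = (-1) ^ n := by
  rw [mul_comm, Complex.exp_int_mul, Complex.exp_pi_mul_I]

lemma neg_one_zpow_thirteen_mul (n : ℤ) : (-1 : ℂ) ^ (13 * n) = (-1) ^ n := by
  rw [zpow_mul]
  norm_num

lemma triTerm_eq_jacobiTheta₂_term (N : ℤ) (z : ℂ) : triTerm N z =
    cexp (Real.pi * I * z / 52) * jacobiTheta₂_term N (1 / 2 + z / 26) (z / 13) := by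
  rw [triTerm, jacobiTheta₂_term, ← cexp_pi_mul_I_mul_int, ← Complex.exp_add, ← Complex.exp_add]
  congr 1
  ring

lemma summable_triTerm {z : ℂ} (hz : 0 < z.im) : Summable fun N => triTerm N z := by
  simp only [triTerm_eq_jacobiTheta₂_term]
  refine Summable.mul_left _ ((summable_jacobiTheta₂_term_iff _ _).2 ?_)
  rw [show z / 13 = z / ((13 : ℝ) : ℂ) by norm_num, Complex.div_ofReal_im]
  positivity

lemma triTerm_thirteen_mul_add (r n : ℤ) (z : ℂ) : triTerm (13 * n + r) z =
    (-1) ^ r * cexp (Real.pi * I * z * (2 * r + 1) ^ 2 / 52) *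
      jacobiTheta₂_term n (1 / 2 + z * (2 * r + 1) / 2) (13 * z) := by
  have : cexp (Real.pi * I * n) * cexp (Real.pi * I * z * (2 * (13 * n + r : ℤ) + 1) ^ 2 / 52) =
      cexp (Real.pi * I * z * (2 * r + 1) ^ 2 / 52) *
        cexp (2 * Real.pi * I * n * (1 / 2 + z * (2 * r + 1) / 2) +
          Real.pi * I * n ^ 2 * (13 * z)) := by
    rw [← Complex.exp_add, ← Complex.exp_add]
    congr 1
    push_cast
    ring
  rw [triTerm, jacobiTheta₂_term, zpow_add₀ (by norm_num), neg_one_zpow_thirteen_mul,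
    ← cexp_pi_mul_I_mul_int n]
  linear_combination (-1) ^ r * this

lemma thetaRes_eq_jacobiTheta₂ (r : ℤ) (z : ℂ) : thetaRes r z =
    (-1) ^ r * cexp (Real.pi * I * z * (2 * r + 1) ^ 2 / 52) *
      jacobiTheta₂ (1 / 2 + z * (2 * r + 1) / 2) (13 * z) := by
  rw [jacobiTheta₂, ← tsum_mul_left, thetaRes]
  exact tsum_congr fun n => triTerm_thirteen_mul_add r n z

lemma triTerm_neg (N : ℤ) (z : ℂ) : triTerm (-1 - N) z = -triTerm N z := by
  rw [triTerm, triTerm, zpow_sub₀ (by norm_num)]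
  have : ((-1 : ℂ) ^ N)⁻¹ = (-1) ^ N := by rw [← inv_zpow, inv_neg_one]
  rw [div_eq_mul_inv, this]
  push_cast
  ring_nf

lemma thetaRes_neg (r : ℤ) (z : ℂ) : thetaRes (-1 - r) z = -thetaRes r z := by
  rw [thetaRes, thetaRes, ← tsum_neg, ← Equiv.tsum_eq (Equiv.neg ℤ)]
  refine tsum_congr fun n => ?_
  rw [← triTerm_neg, Equiv.neg_apply]
  ring_nf

lemma thetaRes_add_thirteen (r : ℤ) (z : ℂ) : thetaRes (r + 13) z = thetaRes r z := by
  rw [thetaRes, thetaRes, ← Equiv.tsum_eq (Equiv.addRight (1 : ℤ)) fun n => triTerm (13 * n + r) z]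
  refine tsum_congr fun n => ?_
  rw [Equiv.coe_addRight]
  ring_nf

lemma qp_mul_thetaSum (k : ℤ) (z : ℂ) :
    qp ((2 * k + 1) ^ 2 / 104) z * thetaSum (2 * k + 1) z = (-1) ^ k * thetaRes k z := by
  rw [thetaSum, thetaRes, ← tsum_mul_left, ← tsum_mul_left]
  refine tsum_congr fun n => ?_
  have hk : (-1 : ℂ) ^ k * (-1) ^ k = 1 := by
    rw [← mul_zpow]
    norm_num
  rw [triTerm, zpow_add₀ (by norm_num), neg_one_zpow_thirteen_mul, qp, qp, mul_left_comm,
    ← Complex.exp_add]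
  have : (-1 : ℂ) ^ k * ((-1) ^ n * (-1) ^ k *
      cexp (Real.pi * I * z * (2 * (13 * n + k : ℤ) + 1) ^ 2 / 52)) =
      (-1) ^ n * cexp (Real.pi * I * z * (2 * (13 * n + k : ℤ) + 1) ^ 2 / 52) := by
    linear_combination
      (-1) ^ n * cexp (Real.pi * I * z * (2 * (13 * n + k : ℤ) + 1) ^ 2 / 52) * hk
  rw [this]
  congr 2
  push_cast
  ring

lemma thc_eq_thetaRes (z : ℂ) : thc 1 z = -thetaRes 5 z ∧ thc 2 z = -thetaRes 3 z ∧
    thc 3 z = thetaRes 2 z ∧ thc 4 z = thetaRes 1 z ∧ thc 5 z = thetaRes 4 z ∧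
    thc 6 z = thetaRes 0 z := by
  have h0 := qp_mul_thetaSum 0 z
  have h1 := qp_mul_thetaSum 1 z
  have h2 := qp_mul_thetaSum 2 z
  have h3 := qp_mul_thetaSum 3 z
  have h4 := qp_mul_thetaSum 4 z
  have h5 := qp_mul_thetaSum 5 z
  norm_num at h0 h1 h2 h3 h4 h5
  simp only [thc]
  norm_num
  exact ⟨h5, h3, h2, by rw [h1, neg_neg], h4, h0⟩

lemma oddExt_Avec (z : ℂ) (l : ℕ) : oddExt (Avec z) l = thetaRes (l + 6) z := by
  obtain ⟨h1, h2, h3, h4, h5, h6⟩ := thc_eq_thetaRes z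
  have hr (r : ℤ) (n : ℕ) : thetaRes (r + 13 * n) z = thetaRes r z := by
    induction n with
    | zero => simp
    | succ n ih =>
      rw [show r + 13 * ((n + 1 : ℕ) : ℤ) = r + 13 * n + 13 by push_cast; ring,
        thetaRes_add_thirteen, ih]
  have hl : thetaRes (l + 6) z = thetaRes ((l % 13 : ℕ) + 6) z := by
    rw [← hr ((l % 13 : ℕ) + 6) (l / 13)]
    congr 1
    omega
  have hl' : oddExt (Avec z) l = oddExt (Avec z) (l % 13 : ℕ) := by rw [ZMod.natCast_mod]
  rw [hl, hl']
  have hlt : l % 13 < 13 := Nat.mod_lt _ (by norm_num)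
  generalize l % 13 = m at hlt
  have e0 : oddExt (Avec z) 0 = 0 := rfl
  have e1 : oddExt (Avec z) 1 = thc 1 z := rfl
  have e2 : oddExt (Avec z) 2 = -thc 5 z := rfl
  have e3 : oddExt (Avec z) 3 = thc 2 z := rfl
  have e4 : oddExt (Avec z) 4 = -thc 3 z := rfl
  have e5 : oddExt (Avec z) 5 = -thc 4 z := rfl
  have e6 : oddExt (Avec z) 6 = -thc 6 z := rfl
  have e7 : oddExt (Avec z) 7 = thc 6 z := rfl
  have e8 : oddExt (Avec z) 8 = thc 4 z := rfl
  have e9 : oddExt (Avec z) 9 = thc 3 z := rfl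
  have e10 : oddExt (Avec z) 10 = -thc 2 z := rfl
  have e11 : oddExt (Avec z) 11 = thc 5 z := rfl
  have e12 : oddExt (Avec z) 12 = -thc 1 z := rfl
  have g6 : thetaRes 6 z = 0 := by
    have a := thetaRes_neg 6 z
    have b := thetaRes_add_thirteen (-7) z
    norm_num at a b
    linear_combination (a + b) / 2
  have g7 := thetaRes_neg 5 z
  have g8 := thetaRes_neg 4 z
  have g9 := thetaRes_neg 3 z
  have g10 := thetaRes_neg 2 z
  have g11 := thetaRes_neg 1 z
  have g12 := thetaRes_neg 0 z
  have g13 := thetaRes_add_thirteen 0 z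
  have g14 := thetaRes_add_thirteen 1 z
  have g15 := thetaRes_add_thirteen 2 z
  have g16 := thetaRes_add_thirteen 3 z
  have g17 := thetaRes_add_thirteen 4 z
  have g18 := thetaRes_add_thirteen 5 z
  rw [← thetaRes_add_thirteen] at g7 g8 g9 g10 g11 g12
  norm_num at g7 g8 g9 g10 g11 g12 g13 g14 g15 g16 g17 g18
  interval_cases m <;>
    norm_num [e0, e1, e2, e3, e4, e5, e6, e7, e8, e9, e10, e11, e12, h1, h2, h3, h4, h5, h6, g6,
      g7, g8, g9, g10, g11, g12, g13, g14, g15, g16, g17, g18]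

lemma thetaRes_add_one (r : ℤ) (z : ℂ) :
    thetaRes r (z + 1) = cexp (Real.pi * I * (2 * r + 1) ^ 2 / 52) * thetaRes r z := by
  rw [thetaRes, thetaRes, ← tsum_mul_left]
  refine tsum_congr fun n => ?_
  obtain ⟨k, hk⟩ : Even (13 * n ^ 2 + n * (2 * r + 1)) := by
    rw [show 13 * n ^ 2 + n * (2 * r + 1) = n * (n + 1) + 2 * (6 * n ^ 2 + n * r) by ring]
    exact (Int.even_mul_succ_self n).add (even_two_mul _)
  have hk' : (13 : ℂ) * n ^ 2 + n * (2 * r + 1) = k + k := by exact_mod_cast hk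
  rw [triTerm, triTerm, mul_left_comm, ← Complex.exp_add]
  congr 1
  rw [Complex.exp_eq_exp_iff_exists_int]
  refine ⟨k, ?_⟩
  push_cast
  linear_combination Real.pi * I * hk'

lemma oddExt_Avec_add_one (z : ℂ) : oddExt (Avec (z + 1)) =
    cexp (13 * Real.pi * I / 4) • twist 1 (oddExt (Avec z)) := by
  funext k
  rw [← ZMod.natCast_zmod_val k]
  generalize k.val = l
  have h : ZMod.stdAddChar (7 * 1 * (l : ZMod 13) ^ 2) = ζ ^ (7 * l ^ 2) := by
    rw [← stdAddChar_natCast]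
    push_cast
    ring_nf
  rw [Pi.smul_apply, smul_eq_mul, twist, oddExt_Avec, oddExt_Avec, thetaRes_add_one, h, zeta13,
    ← Complex.exp_nat_mul, ← mul_assoc, ← Complex.exp_add]
  congr 1
  obtain ⟨k, hk⟩ : Even ((l : ℤ) * (l + 1)) := Int.even_mul_succ_self _
  have hk' : (l : ℂ) * (l + 1) = k + k := by exact_mod_cast hk
  rw [Complex.exp_eq_exp_iff_exists_int]
  refine ⟨l - k, ?_⟩
  push_cast
  linear_combination -Real.pi * I * hk'

lemma relationForm_Avec_add_one (z : ℂ) :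
    relationForm (oddExt (Avec (z + 1))) = -I * relationForm (oddExt (Avec z)) := by
  rw [oddExt_Avec_add_one, relationForm_smul, relationForm_twist, ← Complex.exp_nat_mul,
    show ((30 : ℕ) : ℂ) * (13 * Real.pi * I / 4) = -(Real.pi / 2) * I + (49 : ℤ) * (2 * Real.pi * I)
      by push_cast; ring, Complex.exp_periodic.int_mul, ← Complex.exp_neg_pi_div_two_mul_I]
  congr 2
  ring

lemma tsum_int_eq_sum_range {f : ℤ → ℂ} (hf : Summable f) (r : ℤ) :
    ∑' N, f N = ∑ l ∈ range 13, ∑' n : ℤ, f (13 * n + (l + r)) := by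
  have e : ∀ p : Fin 13 × ℤ, (((Equiv.prodComm _ _).trans (Int.divModEquiv 13).symm).trans
      (Equiv.addRight r)) p = 13 * p.2 + ((p.1 : ℕ) + r) := fun p => by
    simp [Int.divModEquiv]
    ring
  have hs := ((((Equiv.prodComm _ _).trans (Int.divModEquiv 13).symm).trans
    (Equiv.addRight r)).summable_iff).2 hf
  rw [← Equiv.tsum_eq (((Equiv.prodComm _ _).trans (Int.divModEquiv 13).symm).trans
    (Equiv.addRight r))]
  refine (Summable.tsum_prod hs).trans ?_
  rw [tsum_fintype, Finset.sum_range]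
  exact Finset.sum_congr rfl fun l _ => tsum_congr fun n => congrArg f (e (l, n))

lemma thetaRes_functional_equation {z : ℂ} (hz : 0 < z.im) (m : ℕ) : thetaRes (m + 6) z =
    I / (-I * (13 * z)) ^ (1 / 2 : ℂ) *
      ∑ l ∈ range 13, ζ ^ (m * l) * thetaRes (l + 6) (-1 / z) := by
  have hz0 : z ≠ 0 := by
    rintro rfl
    simp at hz
  have hz' : 0 < (-1 / z).im := by
    rw [neg_div, Complex.neg_im, one_div, Complex.inv_im, neg_div, neg_neg]
    exact div_pos hz (Complex.normSq_pos.2 hz0)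
  have hnorm (N : ℤ) : ‖cexp (2 * Real.pi * I * m * (N - 6) / 13)‖ = 1 := by
    rw [show 2 * Real.pi * I * m * (N - 6) / 13 = ((2 * Real.pi * m * (N - 6) / 13 : ℝ) : ℂ) * I by
      push_cast; ring, Complex.norm_exp_ofReal_mul_I]
  have hsum : Summable fun N : ℤ =>
      cexp (2 * Real.pi * I * m * (N - 6) / 13) * triTerm N (-1 / z) := by
    refine Summable.of_norm ?_
    simpa only [norm_mul, hnorm, one_mul] using (summable_triTerm hz').norm
  have hI (w : ℂ) : I * cexp w = cexp (Real.pi / 2 * I + w) := by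
    rw [Complex.exp_add, Complex.exp_pi_div_two_mul_I]
  have hterm (N : ℤ) : (-1) ^ (m + 6 : ℤ) * cexp (Real.pi * I * z * (2 * (m + 6 : ℤ) + 1) ^ 2 / 52) *
      (cexp (-Real.pi * I * (1 / 2 + z * (2 * (m + 6 : ℤ) + 1) / 2) ^ 2 / (13 * z)) *
        jacobiTheta₂_term (N + 1) ((1 / 2 + z * (2 * (m + 6 : ℤ) + 1) / 2) / (13 * z))
          (-1 / (13 * z))) =
      I * (cexp (2 * Real.pi * I * m * (N - 6) / 13) * triTerm N (-1 / z)) := by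
    rw [triTerm, jacobiTheta₂_term, ← cexp_pi_mul_I_mul_int, ← cexp_pi_mul_I_mul_int,
      ← Complex.exp_add, ← Complex.exp_add, ← Complex.exp_add, ← Complex.exp_add,
      ← Complex.exp_add, hI, Complex.exp_eq_exp_iff_exists_int]
    refine ⟨m + 3, ?_⟩
    push_cast
    field_simp
    ring
  have hshift : jacobiTheta₂ ((1 / 2 + z * (2 * (m + 6 : ℤ) + 1) / 2) / (13 * z)) (-1 / (13 * z)) =
      ∑' N : ℤ, jacobiTheta₂_term (N + 1) ((1 / 2 + z * (2 * (m + 6 : ℤ) + 1) / 2) / (13 * z))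
        (-1 / (13 * z)) :=
    (Equiv.tsum_eq (Equiv.addRight (1 : ℤ)) _).symm
  have key : ∑' N : ℤ, cexp (2 * Real.pi * I * m * (N - 6) / 13) * triTerm N (-1 / z) =
      ∑ l ∈ range 13, ζ ^ (m * l) * thetaRes (l + 6) (-1 / z) := by
    rw [tsum_int_eq_sum_range hsum 6]
    refine Finset.sum_congr rfl fun l _ => ?_
    rw [thetaRes, ← tsum_mul_left]
    refine tsum_congr fun n => ?_
    congr 1
    rw [zeta13, ← Complex.exp_nat_mul, Complex.exp_eq_exp_iff_exists_int]
    refine ⟨m * n, ?_⟩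
    push_cast
    ring
  have htsum := tsum_congr (L := .unconditional ℤ) hterm
  rw [tsum_mul_left, tsum_mul_left, tsum_mul_left, ← hshift, key] at htsum
  rw [thetaRes_eq_jacobiTheta₂, jacobiTheta₂_functional_equation]
  linear_combination 1 / (-I * (13 * z)) ^ (1 / 2 : ℂ) * htsum

lemma oddExt_Avec_neg_one_div {z : ℂ} (hz : 0 < z.im) : oddExt (Avec z) =
    (I / (-I * (13 * z)) ^ (1 / 2 : ℂ)) • fourierSum (oddExt (Avec (-1 / z))) := by
  funext k
  rw [← ZMod.natCast_zmod_val k]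
  generalize k.val = m
  rw [Pi.smul_apply, smul_eq_mul, fourierSum, sum_zmod_eq_sum_range, oddExt_Avec,
    thetaRes_functional_equation hz]
  congr 1
  refine Finset.sum_congr rfl fun l _ => ?_
  rw [oddExt_Avec, ← Nat.cast_mul, stdAddChar_natCast]

lemma relationForm_Avec_neg_one_div {z : ℂ} (hz : 0 < z.im) :
    relationForm (oddExt (Avec (-1 / z))) = -I * z ^ 15 * relationForm (oddExt (Avec z)) := by
  have hz0 : z ≠ 0 := by
    rintro rfl
    simp at hz
  have hρ : ((-I * (13 * z)) ^ (1 / 2 : ℂ)) ^ 2 = -I * (13 * z) := by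
    rw [← Complex.cpow_nat_mul]
    norm_num
  have hI : I ^ 15 = -I := by
    rw [show I ^ 15 = (I ^ 4) ^ 3 * (I ^ 2 * I) by ring, Complex.I_pow_four, Complex.I_sq]
    ring
  rw [oddExt_Avec_neg_one_div hz, relationForm_smul, relationForm_fourierSum (oddExt_neg _),
    div_pow, show ((-I * (13 * z)) ^ (1 / 2 : ℂ)) ^ 30 =
      (((-I * (13 * z)) ^ (1 / 2 : ℂ)) ^ 2) ^ 15 by ring, hρ, mul_pow, neg_pow I,
    show I ^ 30 = (I ^ 15) ^ 2 by ring, hI]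
  have := Complex.I_sq
  field_simp
  norm_num

open scoped MatrixGroups

lemma eq_zero_of_weight_six {f : ℂ → ℂ} (hd : DifferentiableOn ℂ f UpperHalfPlane.upperHalfPlaneSet)
    (hT : ∀ z : ℂ, 0 < z.im → f (z + 1) = f z)
    (hS : ∀ z : ℂ, 0 < z.im → f (-1 / z) = z ^ 6 * f z)
    (h0 : Filter.Tendsto (fun τ : UpperHalfPlane => f τ) UpperHalfPlane.atImInfty (nhds 0))
    {z : ℂ} (hz : 0 < z.im) : f z = 0 := by
  have hT' : SlashAction.map (6 : ℤ) ModularGroup.T (fun τ : UpperHalfPlane => f τ) =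
      fun τ : UpperHalfPlane => f τ := by
    ext τ
    rw [ModularForm.SL_slash_apply, ModularGroup.denom_apply, UpperHalfPlane.modular_T_smul,
      ← hT τ τ.im_pos]
    simp [ModularGroup.T, add_comm]
  have hS' : SlashAction.map (6 : ℤ) ModularGroup.S (fun τ : UpperHalfPlane => f τ) =
      fun τ : UpperHalfPlane => f τ := by
    ext τ
    have h := hS τ τ.im_pos
    have h1 : ((UpperHalfPlane.mk (-(τ : ℂ))⁻¹ τ.im_inv_neg_coe_pos : UpperHalfPlane) : ℂ) =
        -1 / τ := by
      rw [UpperHalfPlane.coe_mk, inv_neg, neg_div, one_div]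
    have h2 : (τ : ℂ) ^ 6 * ((τ : ℂ) ^ 6)⁻¹ = 1 :=
      mul_inv_cancel₀ (pow_ne_zero _ (UpperHalfPlane.ne_zero τ))
    rw [ModularForm.SL_slash_apply, UpperHalfPlane.modular_S_smul, ModularGroup.denom_S, h1, h,
      zpow_neg]
    norm_cast at h2 ⊢
    linear_combination f τ * h2
  have hinv (A : Matrix.SpecialLinearGroup (Fin 2) ℤ) :
      SlashAction.map (6 : ℤ) A (fun τ : UpperHalfPlane => f τ) = fun τ : UpperHalfPlane => f τ :=
    SlashInvariantForm.slash_action_generators_SL2Z hS' hT' A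
  let F : CuspForm 𝒮ℒ 6 :=
    { toFun := fun τ => f τ
      slash_action_eq' := fun A hA => by
        obtain ⟨A, rfl⟩ := hA
        exact hinv A
      holo' := by
        rw [UpperHalfPlane.mdifferentiable_iff]
        exact hd.congr fun w hw => by simp [UpperHalfPlane.ofComplex_apply_of_im_pos hw]
      zero_at_cusps' := fun hc => by
        rw [Subgroup.IsArithmetic.isCusp_iff_isCusp_SL2Z] at hc
        rw [OnePoint.isZeroAt_iff_forall_SL2Z hc]
        intro γ _
        rw [hinv]
        exact h0 }
  have hF : F = 0 := rank_zero_iff_forall_zero.1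
    (CuspForm.rank_eq_zero_of_weight_lt_twelve (by norm_num)) F
  exact congrArg (fun G : CuspForm 𝒮ℒ 6 => G ⟨z, hz⟩) hF

lemma eta_add_one_pow (z : ℂ) : ModularForm.eta (z + 1) ^ 18 = -I * ModularForm.eta z ^ 18 := by
  have h1 : cexp (2 * Real.pi * I * (z + 1)) = cexp (2 * Real.pi * I * z) := by
    rw [mul_add, mul_one, Complex.exp_periodic]
  have hI : -I = cexp (-Real.pi / 2 * I) := Complex.exp_neg_pi_div_two_mul_I.symm
  have h2 : Function.Periodic.qParam 24 (z + 1) ^ 18 =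
      -I * Function.Periodic.qParam 24 z ^ 18 := by
    rw [Function.Periodic.qParam, Function.Periodic.qParam, ← Complex.exp_nat_mul,
      ← Complex.exp_nat_mul, hI, ← Complex.exp_add, Complex.exp_eq_exp_iff_exists_int]
    refine ⟨1, ?_⟩
    push_cast
    ring
  simp only [ModularForm.eta, ModularForm.eta_q_eq_pow, h1, mul_pow, h2]
  ring

lemma eta_neg_one_div_pow {z : ℂ} (hz : 0 < z.im) :
    ModularForm.eta (-1 / z) ^ 18 = -I * z ^ 9 * ModularForm.eta z ^ 18 := by
  have hs (w : ℂ) : Complex.sqrt w ^ 18 = w ^ 9 := by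
    have : Complex.sqrt w ^ 2 = w := by
      rw [Complex.sqrt, ← Complex.cpow_nat_mul]
      norm_num
    rw [show Complex.sqrt w ^ 18 = (Complex.sqrt w ^ 2) ^ 9 by ring, this]
  have h := ModularForm.eta_comp_eq_csqrt_I_inv (show z ∈ UpperHalfPlane.upperHalfPlaneSet from hz)
  have hI : (I ^ 9)⁻¹ = -I := by
    rw [show I ^ 9 = (I ^ 4) ^ 2 * I by ring, Complex.I_pow_four, one_pow, one_mul, Complex.inv_I]
  simp only [Function.comp_apply, Pi.smul_apply, Pi.mul_apply, smul_eq_mul] at h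
  rw [h, mul_pow, mul_pow, inv_pow, hs, hs, hI]
  ring

lemma differentiableAt_thetaRes (r : ℤ) {z : ℂ} (hz : 0 < z.im) :
    DifferentiableAt ℂ (thetaRes r) z := by
  have h13 : 0 < (13 * z).im := by simpa using hz
  have h := (hasFDerivAt_jacobiTheta₂ (1 / 2 + z * (2 * r + 1) / 2) h13).differentiableAt
  have h2 : DifferentiableAt ℂ (fun z : ℂ => (1 / 2 + z * (2 * r + 1) / 2, 13 * z)) z := by
    fun_prop
  have h3 : DifferentiableAt ℂ (fun z => jacobiTheta₂ (1 / 2 + z * (2 * r + 1) / 2) (13 * z)) z :=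
    DifferentiableAt.fun_comp' (g := fun p : ℂ × ℂ => jacobiTheta₂ p.1 p.2) z h h2
  rw [show thetaRes r = _ from funext (thetaRes_eq_jacobiTheta₂ r)]
  fun_prop

lemma contDiff_deltaPowerSum (n : ℕ) : ContDiff ℂ 1 (deltaPowerSum n) := by
  unfold deltaPowerSum sextic fourierSum twist
  fun_prop

lemma contDiff_relationForm : ContDiff ℂ 1 relationForm := by
  have := contDiff_deltaPowerSum
  unfold relationForm
  fun_prop

lemma differentiableAt_relationForm_Avec {z : ℂ} (hz : 0 < z.im) :
    DifferentiableAt ℂ (fun z => relationForm (oddExt (Avec z))) z := by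
  refine (contDiff_relationForm.differentiable one_ne_zero _).fun_comp' z
    (differentiableAt_pi.2 fun k => ?_)
  rw [← ZMod.natCast_zmod_val k]
  simp only [oddExt_Avec]
  exact differentiableAt_thetaRes _ hz

lemma relationForm_Avec_eq_zero
    (h0 : Filter.Tendsto (fun τ : UpperHalfPlane =>
      relationForm (oddExt (Avec τ)) / ModularForm.eta τ ^ 18) UpperHalfPlane.atImInfty (nhds 0))
    {z : ℂ} (hz : 0 < z.im) : relationForm (oddExt (Avec z)) = 0 := by
  have hη {w : ℂ} (hw : 0 < w.im) : ModularForm.eta w ^ 18 ≠ 0 :=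
    pow_ne_zero _ (ModularForm.eta_ne_zero hw)
  refine (div_eq_zero_iff.1 (eq_zero_of_weight_six (f := fun w => relationForm (oddExt (Avec w)) /
    ModularForm.eta w ^ 18) ?_ ?_ ?_ h0 hz)).resolve_right (hη hz)
  · exact fun w hw => ((differentiableAt_relationForm_Avec hw).div
      ((ModularForm.differentiableAt_eta_of_mem_upperHalfPlaneSet hw).pow 18)
      (hη hw)).differentiableWithinAt
  · intro w hw
    rw [relationForm_Avec_add_one, eta_add_one_pow,
      mul_div_mul_left _ _ (neg_ne_zero.2 Complex.I_ne_zero)]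
  · intro w hw
    have hw0 : w ≠ 0 := by
      rintro rfl
      simp at hw
    have := hη hw
    have := Complex.I_ne_zero
    rw [relationForm_Avec_neg_one_div hw, eta_neg_one_div_pow hw]
    field_simp

open Asymptotics Topology

/-- The theta constant `thetaRes r z`, divided by `e(z / 104)`, as a series in `u = e(z / 13)`. -/
def thetaSeries (r : ℤ) (u : ℂ) : ℂ :=
  ∑' n : ℤ, (-1) ^ (13 * n + r) * u ^ ((13 * n + r) * (13 * n + r + 1) / 2).toNat

lemma thetaRes_eq_thetaSeries (r : ℤ) (z : ℂ) : thetaRes r z =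
    cexp (Real.pi * I * z / 52) * thetaSeries r (Function.Periodic.qParam 13 z) := by
  rw [thetaRes, thetaSeries, ← tsum_mul_left]
  refine tsum_congr fun n => ?_
  generalize 13 * n + r = N
  have h0 : 0 ≤ N * (N + 1) := by
    rcases le_or_gt 0 N with h | h <;> nlinarith
  have h2 : N * (N + 1) / 2 * 2 = N * (N + 1) :=
    Int.ediv_mul_cancel (Int.even_mul_succ_self N).two_dvd
  have h1 : (((N * (N + 1) / 2).toNat : ℕ) : ℂ) * 2 = N * (N + 1) := by
    rw [← Int.toNat_of_nonneg (Int.ediv_nonneg h0 zero_le_two)] at h2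
    exact_mod_cast h2
  rw [triTerm, Function.Periodic.qParam, ← Complex.exp_nat_mul, mul_left_comm, ← Complex.exp_add]
  congr 2
  push_cast
  linear_combination -Real.pi * I * z / 13 * h1

lemma exists_norm_thetaSeries_sub_le {r : ℤ} (h0 : 0 ≤ r) (h5 : r ≤ 5) :
    ∃ C : ℝ, ∀ u : ℂ, ‖u‖ ≤ 1 / 2 →
      ‖thetaSeries r u - (-1) ^ r * u ^ (r * (r + 1) / 2).toNat‖ ≤ C * ‖u‖ ^ 7 := by
  have hs : Summable fun n : ℤ => (1 / 2 : ℝ) ^ n.natAbs := by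
    refine Summable.of_nat_of_neg ?_ ?_ <;>
      simpa using summable_geometric_of_lt_one (by norm_num : (0 : ℝ) ≤ 1 / 2) (by norm_num)
  refine ⟨∑' n : ℤ, (1 / 2 : ℝ) ^ n.natAbs, fun u hu => ?_⟩
  set f : ℤ → ℂ := fun n =>
    (-1) ^ (13 * n + r) * u ^ ((13 * n + r) * (13 * n + r + 1) / 2).toNat with hf
  have hf0 : f 0 = (-1) ^ r * u ^ (r * (r + 1) / 2).toNat := by simp [hf]
  have hbound (n : ℤ) : ‖if n = 0 then 0 else f n‖ ≤ (1 / 2 : ℝ) ^ n.natAbs * ‖u‖ ^ 7 := by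
    split_ifs with hn
    · rw [norm_zero]
      positivity
    · have hle : n.natAbs + 7 ≤ ((13 * n + r) * (13 * n + r + 1) / 2).toNat := by
        have : 2 * ((n.natAbs : ℤ) + 7) ≤ (13 * n + r) * (13 * n + r + 1) := by
          rcases lt_or_gt_of_ne hn with h | h
          · rw [Int.ofNat_natAbs_of_nonpos h.le]
            nlinarith
          · rw [Int.natAbs_of_nonneg h.le]
            nlinarith
        omega
      have h1 : ‖(-1 : ℂ) ^ (13 * n + r)‖ = 1 := by rw [norm_zpow, norm_neg, norm_one, one_zpow]
      rw [hf, norm_mul, h1, one_mul, norm_pow]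
      calc ‖u‖ ^ ((13 * n + r) * (13 * n + r + 1) / 2).toNat ≤ ‖u‖ ^ (n.natAbs + 7) :=
            pow_le_pow_of_le_one (norm_nonneg _) (hu.trans (by norm_num)) hle
        _ ≤ (1 / 2 : ℝ) ^ n.natAbs * ‖u‖ ^ 7 := by
            rw [pow_add]
            gcongr
  have hsum : Summable fun n : ℤ => if n = 0 then 0 else f n :=
    (hs.mul_right _).of_norm_bounded hbound
  have hsum' : Summable f := by
    refine (summable_congr_cofinite ?_).1 hsum
    filter_upwards [(Set.finite_singleton (0 : ℤ)).compl_mem_cofinite] with n hn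
    exact if_neg hn
  rw [thetaSeries, hsum'.tsum_eq_add_tsum_ite 0, hf0, add_sub_cancel_left, ← tsum_mul_right]
  exact tsum_of_norm_bounded (hs.mul_right _).hasSum hbound

lemma thetaSeries_sub_isBigO {r : ℤ} (h0 : 0 ≤ r) (h5 : r ≤ 5) :
    (fun u : ℂ => thetaSeries r u - (-1) ^ r * u ^ (r * (r + 1) / 2).toNat)
      =O[𝓝 0] fun u => u ^ 7 := by
  obtain ⟨C, hC⟩ := exists_norm_thetaSeries_sub_le h0 h5
  refine IsBigO.of_bound C ?_
  filter_upwards [Metric.closedBall_mem_nhds (0 : ℂ) (by norm_num : (0 : ℝ) < 1 / 2)] with u hu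
  rw [norm_pow]
  exact hC u (by simpa using hu)

/-- The vector of theta constants divided by `e(z / 104)`, as a function of `u = e(z / 13)`. -/
def thetaVec (u : ℂ) : Fin 6 → ℂ :=
  ![-thetaSeries 5 u, -thetaSeries 3 u, thetaSeries 2 u, thetaSeries 1 u, thetaSeries 4 u,
    thetaSeries 0 u]

/-- The truncation of `thetaVec` modulo `u ^ 7`. -/
def thetaVecTrunc (u : ℂ) : Fin 6 → ℂ := ![0, u ^ 6, u ^ 3, -u, 0, 1]

lemma Avec_eq_smul_thetaVec (z : ℂ) :
    Avec z = cexp (Real.pi * I * z / 52) • thetaVec (Function.Periodic.qParam 13 z) := by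
  obtain ⟨h1, h2, h3, h4, h5, h6⟩ := thc_eq_thetaRes z
  simp only [thetaRes_eq_thetaSeries] at h1 h2 h3 h4 h5 h6
  funext i
  fin_cases i
  · exact h1.trans (mul_neg _ _).symm
  · exact h2.trans (mul_neg _ _).symm
  · exact h3
  · exact h4
  · exact h5
  · exact h6

lemma thetaVec_sub_isBigO :
    (fun u => thetaVec u - thetaVecTrunc u) =O[𝓝 0] fun u => u ^ 7 := by
  have hpow {n : ℕ} (hn : 7 < n) : (fun u : ℂ => u ^ n) =O[𝓝 0] fun u => u ^ 7 :=
    (isLittleO_pow_pow hn).isBigO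
  have h0 := thetaSeries_sub_isBigO (r := 0) (by norm_num) (by norm_num)
  have h1 := thetaSeries_sub_isBigO (r := 1) (by norm_num) (by norm_num)
  have h2 := thetaSeries_sub_isBigO (r := 2) (by norm_num) (by norm_num)
  have h3 := thetaSeries_sub_isBigO (r := 3) (by norm_num) (by norm_num)
  have h4 := thetaSeries_sub_isBigO (r := 4) (by norm_num) (by norm_num)
  have h5 := thetaSeries_sub_isBigO (r := 5) (by norm_num) (by norm_num)
  norm_num at h0 h1 h2 h3 h4 h5
  refine isBigO_pi.2 fun i => ?_
  fin_cases i
  · refine ((h5.sub (hpow (show 7 < 15 by norm_num))).neg_left).congr_left fun u => ?_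
    simp [thetaVec, thetaVecTrunc]
  · refine h3.neg_left.congr_left fun u => ?_
    simp [thetaVec, thetaVecTrunc]
    ring
  · refine h2.congr_left fun u => ?_
    simp [thetaVec, thetaVecTrunc]
  · refine h1.congr_left fun u => ?_
    simp [thetaVec, thetaVecTrunc]
  · refine (h4.add (hpow (show 7 < 10 by norm_num))).congr_left fun u => ?_
    simp [thetaVec, thetaVecTrunc]
  · refine h0.congr_left fun u => ?_
    simp [thetaVec, thetaVecTrunc]

lemma contDiff_oddExt : ContDiff ℂ 1 oddExt := by
  refine contDiff_pi.2 fun k => ?_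
  fin_cases k <;> simp only [oddExt] <;> simp <;> fun_prop

lemma oddExt_smul (c : ℂ) (v : Fin 6 → ℂ) : oddExt (c • v) = c • oddExt v := by
  funext k
  rw [Pi.smul_apply]
  fin_cases k <;> simp [oddExt]

lemma continuous_thetaVecTrunc : Continuous thetaVecTrunc := by
  refine continuous_pi fun i => ?_
  fin_cases i <;> simp [thetaVecTrunc] <;> fun_prop

lemma relationForm_thetaVec_sub_isBigO :
    (fun u => relationForm (oddExt (thetaVec u)) - relationForm (oddExt (thetaVecTrunc u)))
      =O[𝓝 0] fun u => u ^ 7 := by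
  have hc : ContDiff ℂ 1 fun v => relationForm (oddExt v) :=
    contDiff_relationForm.comp contDiff_oddExt
  have ht : Filter.Tendsto thetaVecTrunc (𝓝 0) (𝓝 (thetaVecTrunc 0)) :=
    continuous_thetaVecTrunc.tendsto 0
  have hv : Filter.Tendsto thetaVec (𝓝 0) (𝓝 (thetaVecTrunc 0)) := by
    have h : Filter.Tendsto (fun u : ℂ => u ^ 7) (𝓝 0) (𝓝 0) := by
      simpa using (continuous_pow (M := ℂ) 7).tendsto 0
    simpa using (thetaVec_sub_isBigO.trans_tendsto h).add ht
  exact ((hc.contDiffAt.hasStrictFDerivAt one_ne_zero).isBigO_sub.comp_tendsto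
    (hv.prodMk_nhds ht)).trans thetaVec_sub_isBigO

/-- The polynomial `h` with `δ_ν ≡ ω ^ 4 h(ω u)` modulo `u ^ 7` at `thetaVecTrunc u`, where
`ω = ζ ^ ν`. -/
def deltaPoly (x : ℂ) : ℂ := -1 + 2 * x + 2 * x ^ 2 - 2 * x ^ 3 - 8 * x ^ 4 + 6 * x ^ 5 + x ^ 6

lemma deltaF_thetaVecTrunc_sub_isBigO (ν : ℕ) :
    (fun u => deltaF ν (thetaVecTrunc u) - (ζ ^ ν) ^ 4 * deltaPoly (ζ ^ ν * u))
      =O[𝓝 0] fun u => u ^ 7 := by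
  set ω := ζ ^ ν with hω
  have h (u : ℂ) : deltaF ν (thetaVecTrunc u) - ω ^ 4 * deltaPoly (ω * u) = u ^ 7 *
      (ω * (9 * u ^ 3 + 4 * u ^ 16 - u ^ 29) + ω ^ 2 * (-28 * u ^ 4 - 20 * u ^ 17)
        + ω ^ 3 * (7 * u ^ 5 + 6 * u ^ 18) + ω ^ 4 * (-6 * u ^ 6 + u ^ 19)
        + ω ^ 5 * (-6 * u ^ 7 - 8 * u ^ 20) + ω ^ 6 * (34 * u ^ 8 + 4 * u ^ 21)
        - ω ^ 7 * (20 * u ^ 9) + ω ^ 8 * (-8 * u ^ 10 + 4 * u ^ 23) - ω ^ 9 * (36 * u ^ 11)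
        + ω ^ 10 * (36 * u ^ 12) + ω ^ 11 * (-8 - 8 * u ^ 13 - 2 * u ^ 26)
        + ω ^ 12 * (17 * u + 28 * u ^ 14)) := by
    simp only [deltaF, mul_comm _ ν, pow_mul, ← hω, Gs, D, Dinf,
      thetaVecTrunc, deltaPoly]
    simp [Finset.sum_Icc_succ_top]
    ring
  simp only [h]
  simpa using (isBigO_refl (fun u : ℂ => u ^ 7) (𝓝 0)).mul
    ((Continuous.tendsto (by fun_prop) 0).isBigO_one ℂ)

lemma sum_zeta13_pow_pow (s : ℕ) :
    ∑ ν ∈ range 13, (ζ ^ ν) ^ s = if 13 ∣ s then 13 else 0 := by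
  simp only [← pow_mul, mul_comm _ s]
  simp only [pow_mul]
  split_ifs with h
  · obtain ⟨k, rfl⟩ := h
    simp [pow_mul, zeta13_pow]
  · have h1 : ζ ^ s ≠ 1 := fun h' => h (isPrimitiveRoot_zeta13.dvd_of_pow_eq_one s h')
    rw [geom_sum_eq h1, ← pow_mul, mul_comm, pow_mul, zeta13_pow, one_pow, sub_self, zero_div]

lemma sum_deltaPoly_sq (u : ℂ) :
    ∑ ν ∈ range 13, ((ζ ^ ν) ^ 4 * deltaPoly (ζ ^ ν * u)) ^ 2 = -676 * u ^ 5 := by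
  have h (ω : ℂ) : (ω ^ 4 * deltaPoly (ω * u)) ^ 2 =
      ω ^ 8 * (1) + ω ^ 9 * (-4 * u) + ω ^ 11 * (12 * u ^ 3) + ω ^ 12 * (12 * u ^ 4)
        + ω ^ 13 * (-52 * u ^ 5) + ω ^ 14 * (-6 * u ^ 6) + ω ^ 15 * (60 * u ^ 7)
        + ω ^ 16 * (44 * u ^ 8) + ω ^ 17 * (-100 * u ^ 9) + ω ^ 18 * (20 * u ^ 10)
        + ω ^ 19 * (12 * u ^ 11) + ω ^ 20 * (1 * u ^ 12) := by
    unfold deltaPoly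
    ring
  simp only [h, Finset.sum_add_distrib, ← Finset.sum_mul, sum_zeta13_pow_pow]
  norm_num
  ring

lemma sum_deltaPoly_cube (u : ℂ) :
    ∑ ν ∈ range 13, ((ζ ^ ν) ^ 4 * deltaPoly (ζ ^ ν * u)) ^ 3 = 78 * u - 9594 * u ^ 14 := by
  have h (ω : ℂ) : (ω ^ 4 * deltaPoly (ω * u)) ^ 3 =
      ω ^ 12 * (-1) + ω ^ 13 * (6 * u) + ω ^ 14 * (-6 * u ^ 2) + ω ^ 15 * (-22 * u ^ 3)
        + ω ^ 16 * (12 * u ^ 4) + ω ^ 17 * (138 * u ^ 5) + ω ^ 18 * (-121 * u ^ 6)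
        + ω ^ 19 * (-300 * u ^ 7) + ω ^ 20 * (144 * u ^ 8) + ω ^ 21 * (820 * u ^ 9)
        + ω ^ 22 * (-504 * u ^ 10) + ω ^ 23 * (-828 * u ^ 11) + ω ^ 24 * (265 * u ^ 12)
        + ω ^ 25 * (1110 * u ^ 13) + ω ^ 26 * (-738 * u ^ 14) + ω ^ 27 * (-78 * u ^ 15)
        + ω ^ 28 * (84 * u ^ 16) + ω ^ 29 * (18 * u ^ 17) + ω ^ 30 * (1 * u ^ 18) := by
    unfold deltaPoly
    ring
  simp only [h, Finset.sum_add_distrib, ← Finset.sum_mul, sum_zeta13_pow_pow]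
  norm_num
  ring

lemma sum_deltaPoly_pow_five (u : ℂ) :
    ∑ ν ∈ range 13, ((ζ ^ ν) ^ 4 * deltaPoly (ζ ^ ν * u)) ^ 5 = -17095 * u ^ 6 + 1033240 * u ^ 19 := by
  have h (ω : ℂ) : (ω ^ 4 * deltaPoly (ω * u)) ^ 5 =
      ω ^ 20 * (-1) + ω ^ 21 * (10 * u) + ω ^ 22 * (-30 * u ^ 2) + ω ^ 23 * (-10 * u ^ 3)
        + ω ^ 24 * (160 * u ^ 4) + ω ^ 25 * (142 * u ^ 5) + ω ^ 26 * (-1315 * u ^ 6)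
        + ω ^ 27 * (280 * u ^ 7) + ω ^ 28 * (4640 * u ^ 8) + ω ^ 29 * (-40 * u ^ 9)
        + ω ^ 30 * (-18288 * u ^ 10) + ω ^ 31 * (5240 * u ^ 11) + ω ^ 32 * (42430 * u ^ 12)
        + ω ^ 33 * (-4740 * u ^ 13) + ω ^ 34 * (-101820 * u ^ 14) + ω ^ 35 * (27828 * u ^ 15)
        + ω ^ 36 * (147760 * u ^ 16) + ω ^ 37 * (-20540 * u ^ 17) + ω ^ 38 * (-223870 * u ^ 18)
        + ω ^ 39 * (79480 * u ^ 19) + ω ^ 40 * (170672 * u ^ 20) + ω ^ 41 * (-47400 * u ^ 21)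
        + ω ^ 42 * (-154720 * u ^ 22) + ω ^ 43 * (99800 * u ^ 23) + ω ^ 44 * (11395 * u ^ 24)
        + ω ^ 45 * (-16854 * u ^ 25) + ω ^ 46 * (-1750 * u ^ 26) + ω ^ 47 * (1190 * u ^ 27)
        + ω ^ 48 * (320 * u ^ 28) + ω ^ 49 * (30 * u ^ 29) + ω ^ 50 * (1 * u ^ 30) := by
    unfold deltaPoly
    ring
  simp only [h, Finset.sum_add_distrib, ← Finset.sum_mul, sum_zeta13_pow_pow]
  norm_num
  ring

lemma pow_sub_pow_isBigO {f g k : ℂ → ℂ} {l : Filter ℂ} (n : ℕ) (hg : g =O[l] fun _ => (1 : ℂ))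
    (hk : k =O[l] fun _ => (1 : ℂ)) (h : (fun u => f u - g u) =O[l] k) :
    (fun u => f u ^ n - g u ^ n) =O[l] k := by
  have hf : f =O[l] fun _ => (1 : ℂ) := by simpa using (h.trans hk).add hg
  induction n with
  | zero => simpa using isBigO_zero k l
  | succ n ih =>
    have h1 : (fun u => (f u ^ n - g u ^ n) * f u) =O[l] k := by simpa using ih.mul hf
    have h2 : (fun u => g u ^ n * (f u - g u)) =O[l] k := by simpa using (hg.pow n).mul h
    exact (h1.add h2).congr_left fun u => by ring

lemma deltaPowerSum_thetaVecTrunc_sub_isBigO {n : ℕ} (hn : n ≠ 0) :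
    (fun u => deltaPowerSum n (oddExt (thetaVecTrunc u))
      - ∑ ν ∈ range 13, ((ζ ^ ν) ^ 4 * deltaPoly (ζ ^ ν * u)) ^ n) =O[𝓝 0] fun u => u ^ 7 := by
  have h0 (u : ℂ) : deltaInf (thetaVecTrunc u) = 0 := by
    simp [deltaInf, Gs, D, Dinf, thetaVecTrunc]
  simp only [deltaPowerSum_oddExt, h0, zero_pow hn, add_zero, ← Finset.sum_sub_distrib]
  refine IsBigO.fun_sum fun ν _ => pow_sub_pow_isBigO n ?_ ?_ (deltaF_thetaVecTrunc_sub_isBigO ν)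
  · unfold deltaPoly
    exact (Continuous.tendsto (by fun_prop) 0).isBigO_one ℂ
  · exact ((continuous_pow 7).tendsto 0).isBigO_one ℂ

lemma relationForm_thetaVec_isBigO :
    (fun u => relationForm (oddExt (thetaVec u))) =O[𝓝 0] fun u => u ^ 7 := by
  have h2 := deltaPowerSum_thetaVecTrunc_sub_isBigO two_ne_zero
  have h3 := deltaPowerSum_thetaVecTrunc_sub_isBigO three_ne_zero
  have h5 := deltaPowerSum_thetaVecTrunc_sub_isBigO (show 5 ≠ 0 by norm_num)
  simp only [sum_deltaPoly_sq, sum_deltaPoly_cube, sum_deltaPoly_pow_five] at h2 h3 h5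
  have hmul {f g : ℂ → ℂ} (hf : f =O[𝓝 0] fun u => u ^ 7) (hg : Continuous g) :
      (fun u => f u * g u) =O[𝓝 0] fun u => u ^ 7 := by
    simpa using hf.mul ((hg.tendsto 0).isBigO_one ℂ)
  have hc : Continuous fun u => deltaPowerSum 3 (oddExt (thetaVecTrunc u)) :=
    (contDiff_deltaPowerSum 3).continuous.comp (contDiff_oddExt.continuous.comp continuous_thetaVecTrunc)
  have hr := hmul (isBigO_refl _ _) (g := fun u : ℂ => 676 * 9594 * u ^ 12
    - 4056 / 1315 * 1033240 * u ^ 12) (by fun_prop)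
  refine ((((hmul h2 hc).add (hmul h3 (g := fun u => -676 * u ^ 5) (by fun_prop))).sub
    (hmul h5 (g := fun _ => 4056 / 1315) (by fun_prop))).add hr |>.add
    relationForm_thetaVec_sub_isBigO).congr_left fun u => ?_
  simp only [relationForm]
  ring

lemma relationForm_Avec_tendsto : Filter.Tendsto (fun τ : UpperHalfPlane =>
    relationForm (oddExt (Avec τ)) / ModularForm.eta τ ^ 18) UpperHalfPlane.atImInfty (𝓝 0) := by
  have hA (τ : UpperHalfPlane) : relationForm (oddExt (Avec τ)) ^ 4 =
      Function.Periodic.qParam 13 τ ^ 15 *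
        relationForm (oddExt (thetaVec (Function.Periodic.qParam 13 τ))) ^ 4 := by
    rw [Avec_eq_smul_thetaVec, oddExt_smul, relationForm_smul, mul_pow, ← Complex.exp_nat_mul,
      ← Complex.exp_nat_mul, Function.Periodic.qParam, ← Complex.exp_nat_mul]
    congr 2
    push_cast
    ring
  have hq := UpperHalfPlane.qParam_tendsto_atImInfty (show (0 : ℝ) < 13 by norm_num)
  have h1 : (fun u => u ^ 15 * relationForm (oddExt (thetaVec u)) ^ 4) =o[𝓝 0]
      fun u => (u ^ 13) ^ 3 := by
    have h : (fun u : ℂ => u ^ 15 * (u ^ 7) ^ 4) =o[𝓝 0] fun u => u ^ 39 :=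
      (isLittleO_pow_pow (show 39 < 43 by norm_num)).congr_left fun u => by ring
    refine (((isBigO_refl _ _).mul (relationForm_thetaVec_isBigO.pow 4)).trans_isLittleO h).congr_right
      fun u => by ring
  have hΔ : (fun τ : UpperHalfPlane => Function.Periodic.qParam 13 τ ^ 13)
      =O[UpperHalfPlane.atImInfty] ModularForm.discriminant := by
    refine (IsBigO.of_bound 1 (Filter.Eventually.of_forall fun τ => ?_)).trans
      ModularForm.exp_isBigO_discriminant
    rw [Function.Periodic.qParam, ← Complex.exp_nat_mul, Complex.norm_exp]
    refine le_of_eq ?_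
    simp
    ring
  have h2 : (fun τ : UpperHalfPlane => relationForm (oddExt (Avec τ)) ^ 4)
      =o[UpperHalfPlane.atImInfty] fun τ => (ModularForm.eta τ ^ 18) ^ 4 := by
    refine ((h1.comp_tendsto hq).trans_isBigO (hΔ.pow 3)).congr (fun τ => (hA τ).symm) fun τ => ?_
    simp only [ModularForm.discriminant]
    ring
  exact (h2.of_pow four_ne_zero).tendsto_div_nhds_zero

lemma relationForm_X_eq_zero {z : ℂ} (hz : 0 < z.im) : relationForm (oddExt (X z)) = 0 := by
  have h : X z = etaF z • Avec z := rfl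
  rw [h, oddExt_smul, relationForm_smul, relationForm_Avec_eq_zero relationForm_Avec_tendsto hz,
    mul_zero]

/-- `Φ12·Φ18 − Φ30 = 0` at `(x1(z),…,x6(z))`; equivalently
`(Σ δ²)(Σ δ³) = (4056/1315)(Σ δ⁵)` there. -/
theorem stmt_19 (z : ℂ) (hz : 0 < z.im) :
    Phi12 (X z) * Phi18 (X z) - Phi30 (X z) = 0 ∧
    ((∑ ν ∈ Finset.range 13, deltaF ν (X z) ^ 2) + deltaInf (X z) ^ 2) *
        ((∑ ν ∈ Finset.range 13, deltaF ν (X z) ^ 3) + deltaInf (X z) ^ 3) =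
      (4056 / 1315) * ((∑ ν ∈ Finset.range 13, deltaF ν (X z) ^ 5) + deltaInf (X z) ^ 5) := by
  have h := relationForm_X_eq_zero hz
  simp only [relationForm, deltaPowerSum_oddExt] at h
  refine ⟨?_, sub_eq_zero.1 h⟩
  simp only [Phi12, Phi18, Phi30]
  linear_combination -(1 / (13 * 52) * (1 / (13 * 6))) * h

end
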